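/- arXiv:math/9906058 — 4 statements merged into one kernel-verified Lean document; each statement's English description precedes it below -/
import Mathlib

section
/- Let n ≥ 2 be an integer and let r ∈ (−1, 1). Then the Cauchy principal value integral ⨍_{−1}^{1} T_n(s)·√(1−s²)/(s−r) ds exists and equals (π/2)·[T_{n−1}(r) − T_{n+1}(r)]. -/
open Polynomial Chebyshev Filter Set Real

def PVT (r : ℝ) (h : ℝ → ℝ) (L : ℝ) : Prop :=
  Filter.Tendsto (fun ε : ℝ => (∫ s in (-1 : ℝ)..(r - ε), h s / (s - r)) +
    ∫ s in (r + ε)..(1 : ℝ), h s / (s - r)) (nhdsWithin 0 (Set.Ioi 0)) (nhds L)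

lemma pvt_ev (r : ℝ) (hr : r ∈ Set.Ioo (-1 : ℝ) 1) :
    ∀ᶠ ε in nhdsWithin (0:ℝ) (Set.Ioi 0), 0 < ε ∧ -1 < r - ε ∧ r + ε < 1 := by
  have h1 : ∀ᶠ ε in nhdsWithin (0:ℝ) (Set.Ioi 0), ε < r + 1 :=
    nhdsWithin_le_nhds (Iio_mem_nhds (by linarith [hr.1]))
  have h2 : ∀ᶠ ε in nhdsWithin (0:ℝ) (Set.Ioi 0), ε < 1 - r :=
    nhdsWithin_le_nhds (Iio_mem_nhds (by linarith [hr.2]))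
  filter_upwards [h1, h2, self_mem_nhdsWithin] with ε a b c
  exact ⟨c, by linarith, by linarith⟩

lemma pvt_int (r ε : ℝ) (h0 : 0 < ε) (h1 : -1 < r - ε) (h2 : r + ε < 1) (h : ℝ → ℝ)
    (hc : Continuous h) :
    IntervalIntegrable (fun s => h s / (s - r)) MeasureTheory.volume (-1) (r - ε) ∧
    IntervalIntegrable (fun s => h s / (s - r)) MeasureTheory.volume (r + ε) 1 := by
  constructor
  · apply ContinuousOn.intervalIntegrable
    rw [Set.uIcc_of_le h1.le]
    apply ContinuousOn.div hc.continuousOn (by fun_prop)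
    intro x hx
    have := hx.2
    exact ne_of_lt (by linarith)
  · apply ContinuousOn.intervalIntegrable
    rw [Set.uIcc_of_le h2.le]
    apply ContinuousOn.div hc.continuousOn (by fun_prop)
    intro x hx
    have := hx.1
    exact ne_of_gt (by linarith)

lemma pvt_cont (r : ℝ) (k : ℝ → ℝ) (hk : Continuous k) :
    Filter.Tendsto (fun ε : ℝ => (∫ s in (-1 : ℝ)..(r - ε), k s) + ∫ s in (r + ε)..(1 : ℝ), k s)
      (nhdsWithin 0 (Set.Ioi 0)) (nhds (∫ s in (-1:ℝ)..1, k s)) := by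
  have hi : ∀ a b, IntervalIntegrable k MeasureTheory.volume a b :=
    fun a b => hk.intervalIntegrable a b
  have hp := intervalIntegral.continuous_primitive hi (-1)
  have : (fun ε : ℝ => (∫ s in (-1 : ℝ)..(r - ε), k s) + ∫ s in (r + ε)..(1 : ℝ), k s) =
      fun ε : ℝ => (∫ s in (-1 : ℝ)..(r - ε), k s) +
        ((∫ s in (-1:ℝ)..1, k s) - ∫ s in (-1:ℝ)..(r + ε), k s) := by
    funext ε
    rw [intervalIntegral.integral_interval_sub_left (hi _ _) (hi _ _)]
  rw [this]
  have hc : Continuous (fun ε : ℝ => (∫ s in (-1 : ℝ)..(r - ε), k s) +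
        ((∫ s in (-1:ℝ)..1, k s) - ∫ s in (-1:ℝ)..(r + ε), k s)) :=
    (hp.comp (continuous_const.sub continuous_id)).add
      (continuous_const.sub (hp.comp (continuous_const.add continuous_id)))
  have := hc.tendsto 0
  simp only [sub_zero, add_zero, add_sub_cancel] at this
  exact this.mono_left nhdsWithin_le_nhds

lemma pvt_comb (r : ℝ) (hr : r ∈ Set.Ioo (-1 : ℝ) 1) (h h1 h2 k : ℝ → ℝ) (a b A B : ℝ)
    (c1 : Continuous h1) (c2 : Continuous h2) (ck : Continuous k)
    (H1 : PVT r h1 A) (H2 : PVT r h2 B)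
    (e : ∀ s, h s = a * h1 s + b * h2 s + (s - r) * k s) :
    PVT r h (a * A + b * B + ∫ s in (-1:ℝ)..1, k s) := by
  have key := ((H1.const_mul a).add (H2.const_mul b)).add (pvt_cont r k ck)
  refine key.congr' ?_
  filter_upwards [pvt_ev r hr] with ε hε
  obtain ⟨e0, e1, e2⟩ := hε
  obtain ⟨i1, j1⟩ := pvt_int r ε e0 e1 e2 h1 c1
  obtain ⟨i2, j2⟩ := pvt_int r ε e0 e1 e2 h2 c2
  have ik : ∀ a b, IntervalIntegrable k MeasureTheory.volume a b :=
    fun a b => ck.intervalIntegrable a b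
  have E1 : ∫ s in (-1 : ℝ)..(r - ε), h s / (s - r) =
      ∫ s in (-1 : ℝ)..(r - ε), ((a * (h1 s / (s - r)) + b * (h2 s / (s - r))) + k s) := by
    apply intervalIntegral.integral_congr
    intro x hx
    rw [Set.uIcc_of_le e1.le] at hx
    have : x - r ≠ 0 := ne_of_lt (by linarith [hx.2])
    simp only [e]
    field_simp
  have E2 : ∫ s in (r + ε)..1, h s / (s - r) =
      ∫ s in (r + ε)..1, ((a * (h1 s / (s - r)) + b * (h2 s / (s - r))) + k s) := by
    apply intervalIntegral.integral_congr
    intro x hx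
    rw [Set.uIcc_of_le e2.le] at hx
    have : x - r ≠ 0 := ne_of_gt (by linarith [hx.1])
    simp only [e]
    field_simp
  rw [E1, E2, intervalIntegral.integral_add ((i1.const_mul a).add (i2.const_mul b)) (ik _ _),
    intervalIntegral.integral_add ((j1.const_mul a).add (j2.const_mul b)) (ik _ _),
    intervalIntegral.integral_add (i1.const_mul a) (i2.const_mul b),
    intervalIntegral.integral_add (j1.const_mul a) (j2.const_mul b)]
  simp only [intervalIntegral.integral_const_mul]
  ring

lemma pos_aux (r s : ℝ) (hr : r ∈ Set.Ioo (-1 : ℝ) 1) (hs : s ∈ Set.Icc (-1:ℝ) 1) :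
    0 < 1 - r * s + √(1 - r^2) * √(1 - s^2) := by
  have : 0 ≤ √(1 - r^2) * √(1 - s^2) := by positivity
  obtain ⟨a, b⟩ := hr
  obtain ⟨c, d⟩ := hs
  have : r * s < 1 := by
    rcases le_total 0 s with h | h <;> nlinarith
  linarith

noncomputable def FF (r s : ℝ) : ℝ := √(1 - s^2) - r * arcsin s
  - √(1 - r^2) * (log (1 - r * s + √(1 - r^2) * √(1 - s^2)) - log (s - r))

noncomputable def GG (r s : ℝ) : ℝ := √(1 - s^2) - r * arcsin s
  - √(1 - r^2) * log (1 - r * s + √(1 - r^2) * √(1 - s^2))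

lemma FF_deriv (r s : ℝ) (hr : r ∈ Set.Ioo (-1 : ℝ) 1) (hs : s ∈ Set.Ioo (-1:ℝ) 1)
    (hne : s - r ≠ 0) : HasDerivAt (FF r) (√(1 - s^2) / (s - r)) s := by
  have hp := pos_aux r s hr ⟨hs.1.le, hs.2.le⟩
  have hq : 0 < 1 - s^2 := by nlinarith [hs.1, hs.2]
  have hw : 0 < 1 - r^2 := by nlinarith [hr.1, hr.2]
  have hqs : 0 < √(1 - s^2) := Real.sqrt_pos.2 hq
  have d1 : HasDerivAt (fun s : ℝ => √(1 - s^2)) (-(2 * s) / (2 * √(1 - s^2))) s := by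
    have : HasDerivAt (fun s : ℝ => 1 - s^2) (-(2 * s)) s := by
      simpa using (hasDerivAt_pow 2 s).const_sub 1
    exact this.sqrt hq.ne'
  have d2 := hasDerivAt_arcsin (x := s) (by linarith [hs.1]) (by linarith [hs.2])
  have d3 : HasDerivAt (fun s : ℝ => 1 - r * s + √(1 - r^2) * √(1 - s^2))
      (-r + √(1 - r^2) * (-(2 * s) / (2 * √(1 - s^2)))) s := by
    have : HasDerivAt (fun s : ℝ => 1 - r * s) (-r) s := by
      simpa using ((hasDerivAt_id s).const_mul r).const_sub 1
    exact this.add (d1.const_mul _)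
  have d4 : HasDerivAt (fun s : ℝ => s - r) 1 s := (hasDerivAt_id s).sub_const r
  have := (d1.sub (d2.const_mul r)).sub
    (((d3.log hp.ne').sub (d4.log hne)).const_mul (√(1 - r^2)))
  refine this.congr_deriv ?_
  have q2 : √(1 - s^2) ^ 2 = 1 - s^2 := Real.sq_sqrt hq.le
  have w2 : √(1 - r^2) ^ 2 = 1 - r^2 := Real.sq_sqrt hw.le
  set q := √(1 - s^2)
  set w := √(1 - r^2)
  have hp' := hp.ne'
  have K : (-r + w * (-(2 * s) / (2 * q))) / (1 - r * s + w * q) - 1 / (s - r)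
      = - w / ((s - r) * q) := by
    field_simp
    linear_combination (-w) * q2 + q * w2
  rw [K]
  field_simp
  linear_combination w2 - q2

lemma FF_cont (r a b : ℝ) (hr : r ∈ Set.Ioo (-1 : ℝ) 1) (ha : -1 ≤ a) (hb : b ≤ 1)
    (h : ∀ s ∈ Set.Icc a b, s - r ≠ 0) : ContinuousOn (FF r) (Set.Icc a b) := by
  unfold FF
  have c1 : ContinuousOn (fun s : ℝ => log (1 - r * s + √(1 - r^2) * √(1 - s^2))) (Set.Icc a b) :=
    ContinuousOn.log (by fun_prop)
      (fun s hs => (pos_aux r s hr ⟨ha.trans hs.1, hs.2.trans hb⟩).ne')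
  have c2 : ContinuousOn (fun s : ℝ => log (s - r)) (Set.Icc a b) :=
    ContinuousOn.log (by fun_prop) h
  have c3 : Continuous (fun s : ℝ => √(1 - s^2) - r * arcsin s) := by
    have := continuous_arcsin
    fun_prop
  exact c3.continuousOn.sub (continuousOn_const.mul (c1.sub c2))

lemma pvt_base (r : ℝ) (hr : r ∈ Set.Ioo (-1 : ℝ) 1) :
    PVT r (fun s => √(1 - s^2)) (- π * r) := by
  have hG : ContinuousAt (GG r) r := by
    have hp := pos_aux r r hr ⟨hr.1.le, hr.2.le⟩
    have := continuous_arcsin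
    unfold GG
    have c1 : ContinuousAt (fun s : ℝ => log (1 - r * s + √(1 - r^2) * √(1 - s^2))) r :=
      ContinuousAt.log (by fun_prop) hp.ne'
    have c3 : Continuous (fun s : ℝ => √(1 - s^2) - r * arcsin s) := by fun_prop
    exact c3.continuousAt.sub (continuousAt_const.mul c1)
  have t1 : Tendsto (fun ε : ℝ => GG r (r - ε)) (nhdsWithin 0 (Set.Ioi 0)) (nhds (GG r r)) := by
    refine (Tendsto.comp hG ?_).mono_left nhdsWithin_le_nhds
    have : Continuous (fun ε : ℝ => r - ε) := by fun_prop
    simpa using this.tendsto 0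
  have t2 : Tendsto (fun ε : ℝ => GG r (r + ε)) (nhdsWithin 0 (Set.Ioi 0)) (nhds (GG r r)) := by
    refine (Tendsto.comp hG ?_).mono_left nhdsWithin_le_nhds
    have : Continuous (fun ε : ℝ => r + ε) := by fun_prop
    simpa using this.tendsto 0
  have key := (t1.sub t2).add_const (- π * r)
  rw [sub_self, zero_add] at key
  refine key.congr' ?_
  filter_upwards [pvt_ev r hr] with ε hε
  obtain ⟨e0, e1, e2⟩ := hε
  obtain ⟨i, j⟩ := pvt_int r ε e0 e1 e2 (fun s => √(1 - s^2)) (by fun_prop)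
  rw [intervalIntegral.integral_eq_sub_of_hasDerivAt_of_le e1.le
      (FF_cont r _ _ hr le_rfl (by linarith) (fun s hs => ne_of_lt (by linarith [hs.2])))
      (fun x hx => FF_deriv r x hr ⟨hx.1, by linarith [hx.2]⟩ (ne_of_lt (by linarith [hx.2]))) i,
    intervalIntegral.integral_eq_sub_of_hasDerivAt_of_le e2.le
      (FF_cont r _ _ hr (by linarith) le_rfl (fun s hs => ne_of_gt (by linarith [hs.1])))
      (fun x hx => FF_deriv r x hr ⟨by linarith [hx.1], hx.2⟩ (ne_of_gt (by linarith [hx.1]))) j]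
  have f1 : FF r 1 = - r * (π / 2) := by
    simp [FF]
  have f2 : FF r (-1) = r * (π / 2) := by
    have : (-1 - r) = -(1 + r) := by ring
    simp [FF, this, -neg_add_rev]
  have l1 : log (r - ε - r) = log ε := by
    rw [show r - ε - r = -ε by ring, Real.log_neg_eq_log]
  have l2 : log (r + ε - r) = log ε := by
    rw [show r + ε - r = ε by ring]
  rw [f1, f2]
  simp only [FF, GG, l1, l2]
  ring

lemma int_U (n : ℕ) : ∫ s in (-1:ℝ)..1, (U ℝ n).eval s * √(1 - s^2) =
    if n = 0 then π / 2 else 0 := by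
  have h1 : ∫ s in (-1:ℝ)..1, (U ℝ n).eval s * √(1 - s^2) =
      ∫ x, ((T ℝ n).eval x - (T ℝ (n + 2)).eval x) / 2 ∂measureT := by
    rw [integral_measureT]
    apply intervalIntegral.integral_congr
    intro x hx
    rw [Set.uIcc_of_le (by norm_num)] at hx
    have hq : 0 ≤ 1 - x^2 := by nlinarith [hx.1, hx.2]
    have a := congrArg (Polynomial.eval x) (T_eq_X_mul_T_sub_pol_U ℝ n)
    have b := congrArg (Polynomial.eval x) (T_add_two ℝ n)
    simp only [eval_sub, eval_mul, eval_X, eval_one, eval_pow, eval_ofNat] at a b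
    have : ((T ℝ n).eval x - (T ℝ (n + 2)).eval x) / 2 = (1 - x^2) * (U ℝ n).eval x := by
      linarith
    simp only [this]
    rcases hq.eq_or_lt with h | h
    · simp [← h]
    · have h' := Real.sqrt_pos.2 h
      have h2 := Real.sq_sqrt hq
      simp only [Real.sqrt_inv]
      field_simp
      rw [h2]
  have hT : ∀ m : ℤ, MeasureTheory.Integrable (fun x => (T ℝ m).eval x) measureT :=
    fun m => integrable_measureT (by fun_prop)
  rw [h1, MeasureTheory.integral_div, MeasureTheory.integral_sub (hT _) (hT _),
    integral_eval_T_real_measureT_of_ne_zero (n := (n:ℤ) + 2) (by omega)]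
  split_ifs with h
  · subst h
    simp only [Nat.cast_zero]
    rw [integral_eval_T_real_measureT_zero]; simp
  · rw [integral_eval_T_real_measureT_of_ne_zero (by exact_mod_cast h)]; simp

lemma pvt_U (r : ℝ) (hr : r ∈ Set.Ioo (-1 : ℝ) 1) (n : ℕ) :
    PVT r (fun s => (U ℝ n).eval s * √(1 - s^2)) (- π * (T ℝ (n + 1)).eval r) ∧
    PVT r (fun s => (U ℝ (n + 1)).eval s * √(1 - s^2)) (- π * (T ℝ (n + 2)).eval r) := by
  induction n with
  | zero =>
    have h0 : PVT r (fun s => (U ℝ 0).eval s * √(1 - s^2)) (- π * r) := by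
      simpa using pvt_base r hr
    refine ⟨by simpa using h0, ?_⟩
    have := pvt_comb r hr (fun s => (U ℝ 1).eval s * √(1 - s^2)) _ _
      (fun s => 2 * ((U ℝ (0:ℕ)).eval s * √(1 - s^2))) (2 * r) 0 _ _
      (by fun_prop) (by fun_prop) (by fun_prop) h0 h0 (by intro s; simp; ring)
    rw [intervalIntegral.integral_const_mul, int_U] at this
    convert this using 1
    · simp
    · simp [T_two]; ring
  | succ n ih =>
    obtain ⟨a, b⟩ := ih
    refine ⟨by push_cast; convert b using 3; ring_nf, ?_⟩
    have := pvt_comb r hr (fun s => (U ℝ (n + 2)).eval s * √(1 - s^2)) _ _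
      (fun s => 2 * ((U ℝ ((n + 1 : ℕ))).eval s * √(1 - s^2))) (2 * r) (-1) _ _
      (by fun_prop) (by fun_prop) (by fun_prop) b a
      (by intro s; simp [U_add_two]; ring)
    rw [intervalIntegral.integral_const_mul, int_U] at this
    push_cast
    have e1 : (n : ℤ) + 1 + 1 = n + 2 := by ring
    have e2 : (n : ℤ) + 1 + 2 = (n + 1) + 2 := by ring
    rw [e1, T_add_two, e1]
    convert this using 1
    simp; ring

/-- For an integer `n ≥ 2` and `r ∈ (-1, 1)`, the Cauchy principal value
integral `⨍_{-1}^{1} T_n(s) √(1-s²)/(s-r) ds` exists and equals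
`(π/2) (T_{n-1}(r) - T_{n+1}(r))`. -/
theorem cpv_T_m1 (n : ℕ) (hn : 2 ≤ n) (r : ℝ) (hr : r ∈ Set.Ioo (-1 : ℝ) 1) :
    Filter.Tendsto
      (fun ε : ℝ =>
        (∫ s in (-1 : ℝ)..(r - ε),
            (Polynomial.Chebyshev.T ℝ n).eval s * Real.sqrt (1 - s ^ 2) / (s - r)) +
        ∫ s in (r + ε)..(1 : ℝ),
            (Polynomial.Chebyshev.T ℝ n).eval s * Real.sqrt (1 - s ^ 2) / (s - r))
      (nhdsWithin 0 (Set.Ioi 0))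
      (nhds (Real.pi / 2 *
        ((Polynomial.Chebyshev.T ℝ ((n : ℤ) - 1)).eval r -
         (Polynomial.Chebyshev.T ℝ ((n : ℤ) + 1)).eval r))) := by
  obtain ⟨m, rfl⟩ := Nat.exists_eq_add_of_le' hn
  have h1 := (pvt_U r hr m).1
  have h2 := (pvt_U r hr (m + 2)).1
  have := pvt_comb r hr (fun s => (T ℝ ((m + 2 : ℕ))).eval s * √(1 - s^2)) _ _
      (fun s => 0) (1/2) (-1/2) _ _ (by fun_prop) (by fun_prop) (by fun_prop) h2 h1
      (by
        intro s
        have := congrArg (Polynomial.eval s) (two_mul_T_eq_U_sub_U ℝ m)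
        simp only [eval_sub, eval_mul, eval_ofNat] at this
        push_cast
        linear_combination (1/2) * √(1 - s^2) * this)
  have e1 : ((m + 2 : ℕ) : ℤ) - 1 = m + 1 := by push_cast; ring
  rw [e1]
  unfold PVT at this
  convert this using 2
  simp; ring
end

section
/- Let m ≥ 1 and n ≥ 2m + 1 be integers and define F : (−1, 1) → ℝ by F(r) = ⨍_{−1}^{1} T_n(s)·(1−s²)^{m−1/2}/(s−r) ds (Cauchy principal value). Then F is differentiable at every r ∈ (−1, 1) and F′(r) = π·(−1)^{m+1}·(1/2)^{2m−1} · Σ_{j=0}^{2m−1} (−1)^j · C(2m−1, j) · (n+1−2m+2j) · U_{n−2m+2j}(r), where C(2m−1, j) denotes the binomial coefficient. (F′(r) is the Hadamard finite-part integral ⨎_{−1}^{1} T_n(s)·(1−s²)^{m−1/2}/(s−r)² ds.) -/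
open Filter Topology Set in
def IsPV (g : ℝ → ℝ) (r L : ℝ) : Prop :=
  Filter.Tendsto (fun ε : ℝ => (∫ s in (-1 : ℝ)..(r - ε), g s / (s - r)) +
    ∫ s in (r + ε)..(1 : ℝ), g s / (s - r)) (nhdsWithin 0 (Set.Ioi 0)) (nhds L)

lemma ev_small {r : ℝ} (hr : r ∈ Set.Ioo (-1 : ℝ) 1) :
    ∀ᶠ ε in nhdsWithin (0:ℝ) (Set.Ioi 0), 0 < ε ∧ -1 < r - ε ∧ r + ε < 1 := by
  have h : Set.Ioo (0:ℝ) (min (r+1) (1-r)) ∈ nhdsWithin (0:ℝ) (Set.Ioi 0) :=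
    Ioo_mem_nhdsGT (lt_min (by linarith [hr.1]) (by linarith [hr.2]))
  filter_upwards [h] with ε hε
  have h1 := lt_of_lt_of_le hε.2 (min_le_left _ _)
  have h2 := lt_of_lt_of_le hε.2 (min_le_right _ _)
  exact ⟨hε.1, by linarith, by linarith⟩

lemma intL {g : ℝ → ℝ} (hg : Continuous g) {r ε : ℝ} (h0 : 0 < ε) (h1 : -1 < r - ε) :
    IntervalIntegrable (fun s => g s / (s - r)) MeasureTheory.volume (-1) (r - ε) := by
  apply ContinuousOn.intervalIntegrable
  apply ContinuousOn.div hg.continuousOn (by fun_prop)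
  intro x hx
  rw [Set.uIcc_of_le h1.le] at hx
  have := hx.2
  intro h; linarith

lemma intR {g : ℝ → ℝ} (hg : Continuous g) {r ε : ℝ} (h0 : 0 < ε) (h1 : r + ε < 1) :
    IntervalIntegrable (fun s => g s / (s - r)) MeasureTheory.volume (r + ε) 1 := by
  apply ContinuousOn.intervalIntegrable
  apply ContinuousOn.div hg.continuousOn (by fun_prop)
  intro x hx
  rw [Set.uIcc_of_le h1.le] at hx
  have := hx.1
  intro h; linarith

lemma IsPV.lin {g₁ g₂ : ℝ → ℝ} {r L₁ L₂ : ℝ} (hr : r ∈ Set.Ioo (-1 : ℝ) 1)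
    (h1 : Continuous g₁) (h2 : Continuous g₂)
    (p1 : IsPV g₁ r L₁) (p2 : IsPV g₂ r L₂) (a b : ℝ) :
    IsPV (fun s => a * g₁ s + b * g₂ s) r (a * L₁ + b * L₂) := by
  have := (p1.const_mul a).add (p2.const_mul b)
  refine Filter.Tendsto.congr' ?_ this
  filter_upwards [ev_small hr] with ε ⟨h0, hl, hu⟩
  have e : (fun s => (a * g₁ s + b * g₂ s) / (s - r)) =
    fun s => a * (g₁ s / (s - r)) + b * (g₂ s / (s - r)) := by
    funext s; ring
  rw [e, intervalIntegral.integral_add ((intL h1 h0 hl).const_mul a) ((intL h2 h0 hl).const_mul b),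
    intervalIntegral.integral_add ((intR h1 h0 hu).const_mul a) ((intR h2 h0 hu).const_mul b)]
  simp only [intervalIntegral.integral_const_mul]
  ring

lemma IsPV.congr {g₁ g₂ : ℝ → ℝ} {r L : ℝ} (hr : r ∈ Set.Ioo (-1 : ℝ) 1)
    (h : ∀ s ∈ Set.Icc (-1:ℝ) 1, g₁ s = g₂ s) (p : IsPV g₁ r L) : IsPV g₂ r L := by
  refine Filter.Tendsto.congr' ?_ p
  filter_upwards [ev_small hr] with ε ⟨h0, hl, hu⟩
  congr 1
  · apply intervalIntegral.integral_congr
    intro s hs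
    rw [Set.uIcc_of_le hl.le] at hs
    simp only
    rw [h s ⟨hs.1, by linarith [hs.2]⟩]
  · apply intervalIntegral.integral_congr
    intro s hs
    rw [Set.uIcc_of_le hu.le] at hs
    simp only
    rw [h s ⟨by linarith [hs.1], hs.2⟩]

lemma IsPV.sum {ι : Type*} (t : Finset ι) (c : ι → ℝ) (g : ι → ℝ → ℝ) (L : ι → ℝ) {r : ℝ}
    (hr : r ∈ Set.Ioo (-1 : ℝ) 1) (hg : ∀ i ∈ t, Continuous (g i))
    (p : ∀ i ∈ t, IsPV (g i) r (L i)) :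
    IsPV (fun s => ∑ i ∈ t, c i * g i s) r (∑ i ∈ t, c i * L i) := by
  classical
  induction t using Finset.induction_on with
  | empty => simp [IsPV]
  | insert i t hi ih =>
    have h1 := ih (fun j hj => hg j (Finset.mem_insert_of_mem hj))
      (fun j hj => p j (Finset.mem_insert_of_mem hj))
    have h2 := IsPV.lin hr (hg i (Finset.mem_insert_self _ _))
      (continuous_finsetSum t (fun j hj => (hg j (Finset.mem_insert_of_mem hj)).const_mul (c j)))
      (p i (Finset.mem_insert_self _ _)) h1 (c i) 1
    simpa [Finset.sum_insert hi] using h2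

lemma isPV_reg {g : ℝ → ℝ} (hg : Continuous g) {r : ℝ} (hr : r ∈ Set.Ioo (-1 : ℝ) 1) :
    IsPV (fun s => (s - r) * g s) r (∫ s in (-1:ℝ)..1, g s) := by
  have hc : Continuous (fun x => ∫ s in (-1:ℝ)..x, g s) :=
    intervalIntegral.continuous_primitive (fun a b => hg.intervalIntegrable a b) _
  have hlim : Filter.Tendsto (fun ε : ℝ => (∫ s in (-1:ℝ)..(r-ε), g s) +
      ((∫ s in (-1:ℝ)..1, g s) - ∫ s in (-1:ℝ)..(r+ε), g s)) (nhds 0)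
      (nhds ((∫ s in (-1:ℝ)..(r-0), g s) +
      ((∫ s in (-1:ℝ)..1, g s) - ∫ s in (-1:ℝ)..(r+0), g s))) := by
    apply Continuous.tendsto (f := fun ε : ℝ => (∫ s in (-1:ℝ)..(r-ε), g s) +
      ((∫ s in (-1:ℝ)..1, g s) - ∫ s in (-1:ℝ)..(r+ε), g s))
    have h1 := hc.comp (continuous_const.sub continuous_id : Continuous fun ε : ℝ => r - ε)
    have h2 := hc.comp (continuous_const.add continuous_id : Continuous fun ε : ℝ => r + ε)
    exact h1.add (continuous_const.sub h2)
  have e : (∫ s in (-1:ℝ)..(r-0), g s) +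
      ((∫ s in (-1:ℝ)..1, g s) - ∫ s in (-1:ℝ)..(r+0), g s) = ∫ s in (-1:ℝ)..1, g s := by
    simp
  rw [e] at hlim
  refine Filter.Tendsto.congr' ?_ (hlim.mono_left nhdsWithin_le_nhds)
  filter_upwards [ev_small hr] with ε ⟨h0, hl, hu⟩
  rw [intervalIntegral.integral_interval_sub_left (hg.intervalIntegrable _ _)
    (hg.intervalIntegrable _ _)]
  congr 1
  · apply intervalIntegral.integral_congr
    intro s hs
    rw [Set.uIcc_of_le hl.le] at hs
    have : s - r ≠ 0 := by have := hs.2; intro h; linarith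
    simp only
    field_simp
  · apply intervalIntegral.integral_congr
    intro s hs
    rw [Set.uIcc_of_le hu.le] at hs
    have : s - r ≠ 0 := by have := hs.1; intro h; linarith
    simp only
    field_simp

lemma IsPV.mul_id {g : ℝ → ℝ} (hg : Continuous g) {r L : ℝ} (hr : r ∈ Set.Ioo (-1 : ℝ) 1)
    (p : IsPV g r L) : IsPV (fun s => s * g s) r ((∫ s in (-1:ℝ)..1, g s) + r * L) := by
  have := IsPV.lin hr (by fun_prop) hg (isPV_reg hg hr) p 1 r
  rw [one_mul] at this
  exact this.congr hr (fun s _ => by ring)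

lemma isPV_sqrt {r : ℝ} (hr : r ∈ Set.Ioo (-1 : ℝ) 1) :
    IsPV (fun s => √(1 - s ^ 2)) r (-Real.pi * r) := by
  set a := √(1 - r ^ 2) with ha
  have ha2 : a ^ 2 = 1 - r ^ 2 := Real.sq_sqrt (by nlinarith [hr.1, hr.2])
  have ha0 : 0 ≤ a := Real.sqrt_nonneg _
  set H : ℝ → ℝ := fun s => - a * Real.log (1 - r * s + a * √(1 - s ^ 2)) + √(1 - s ^ 2)
    - r * Real.arcsin s with hH
  set G : ℝ → ℝ := fun s => a * Real.log (s - r) + H s with hG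
  have hN : ∀ s ∈ Set.Icc (-1:ℝ) 1, 0 < 1 - r * s + a * √(1 - s ^ 2) := by
    intro s hs
    have : 0 < 1 - r * s := by
      have := hr.1; have := hr.2; have := hs.1; have := hs.2
      rcases le_total 0 s with h | h <;> nlinarith
    have := mul_nonneg ha0 (Real.sqrt_nonneg (1 - s ^ 2))
    linarith
  have hHc : ContinuousOn H (Set.Icc (-1) 1) := by
    have : ContinuousOn (fun s : ℝ => Real.log (1 - r * s + a * √(1 - s ^ 2))) (Set.Icc (-1) 1) :=
      ContinuousOn.log (by fun_prop) (fun s hs => (hN s hs).ne')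
    have h2 := Real.continuous_arcsin
    rw [hH]
    fun_prop
  have hGc : ContinuousOn G (Set.Icc (-1) 1 \ {r}) := by
    apply ContinuousOn.add _ (hHc.mono Set.sdiff_subset)
    apply ContinuousOn.mul continuousOn_const
    apply ContinuousOn.log (by fun_prop)
    intro x hx h
    exact hx.2 (by simp; linarith)
  have hGd : ∀ s ∈ Set.Ioo (-1:ℝ) 1, s ≠ r → HasDerivAt G (√(1 - s ^ 2) / (s - r)) s := by
    intro s hs hsr
    have hpos : 0 < 1 - s ^ 2 := by nlinarith [hs.1, hs.2]
    have hw0 : 0 < √(1 - s ^ 2) := Real.sqrt_pos.mpr hpos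
    have hw2 : √(1 - s ^ 2) ^ 2 = 1 - s ^ 2 := Real.sq_sqrt hpos.le
    have hsr' : s - r ≠ 0 := sub_ne_zero.mpr hsr
    have dw : HasDerivAt (fun s : ℝ => √(1 - s ^ 2)) (-s / √(1 - s ^ 2)) s := by
      have h1 : HasDerivAt (fun s : ℝ => 1 - s ^ 2) (-(2 * s)) s := by
        simpa using (hasDerivAt_pow 2 s).const_sub 1
      convert h1.sqrt hpos.ne' using 1
      field_simp
    have dN : HasDerivAt (fun s : ℝ => 1 - r * s + a * √(1 - s ^ 2))
        (-r + a * (-s / √(1 - s ^ 2))) s := by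
      have h1 : HasDerivAt (fun s : ℝ => 1 - r * s) (-r) s := by
        simpa using ((hasDerivAt_id s).const_mul r).const_sub 1
      exact h1.add (dw.const_mul a)
    have hNs := hN s ⟨hs.1.le, hs.2.le⟩
    have dl := dN.log hNs.ne'
    have dl2 : HasDerivAt (fun s : ℝ => Real.log (s - r)) (1 / (s - r)) s :=
      ((hasDerivAt_id s).sub_const r).log hsr'
    have das := Real.hasDerivAt_arcsin hs.1.ne' hs.2.ne
    have tot := (dl2.const_mul a).add (((dl.const_mul (-a)).add dw).sub (das.const_mul r))
    convert! tot using 1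
    set w := √(1 - s ^ 2)
    have k : -r + a * (-s / w) = (1 - r * s + a * w) / (s - r) - a * (1 - r * s + a * w) / (w * (s - r)) := by
      field_simp
      linear_combination w * ha2 - a * hw2
    rw [k]
    have hNs' := hNs.ne'
    have k2 : ((1 - r * s + a * w) / (s - r) - a * (1 - r * s + a * w) / (w * (s - r))) / (1 - r * s + a * w)
      = 1 / (s - r) - a / (w * (s - r)) := by
      field_simp
    rw [k2]
    field_simp
    linear_combination hw2 - ha2
  have cw : Continuous (fun s : ℝ => √(1 - s ^ 2)) := by fun_prop
  have hHr : ContinuousAt H r := hHc.continuousAt (Icc_mem_nhds hr.1 hr.2)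
  have l1 : Filter.Tendsto (fun ε : ℝ => H (r - ε)) (nhds 0) (nhds (H r)) := by
    have : Filter.Tendsto (fun ε : ℝ => r - ε) (nhds 0) (nhds r) := by
      simpa using (Continuous.tendsto (by fun_prop : Continuous (fun ε : ℝ => r - ε)) 0)
    exact hHr.tendsto.comp this
  have l2 : Filter.Tendsto (fun ε : ℝ => H (r + ε)) (nhds 0) (nhds (H r)) := by
    have : Filter.Tendsto (fun ε : ℝ => r + ε) (nhds 0) (nhds r) := by
      simpa using (Continuous.tendsto (by fun_prop : Continuous (fun ε : ℝ => r + ε)) 0)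
    exact hHr.tendsto.comp this
  have l3 := ((l1.sub l2).add_const (G 1 - G (-1))).mono_left
    (nhdsWithin_le_nhds (s := Set.Ioi 0))
  have hv : H r - H r + (G 1 - G (-1)) = - Real.pi * r := by
    have : Real.log (-1 - r) = Real.log (1 + r) := by
      rw [← Real.log_neg_eq_log]; congr 1; ring
    simp [hG, hH, this]
    ring
  rw [hv] at l3
  refine Filter.Tendsto.congr' ?_ l3
  filter_upwards [ev_small hr] with ε ⟨h0, hl, hu⟩
  have i1 : ∫ s in (-1 : ℝ)..(r - ε), √(1 - s ^ 2) / (s - r) = G (r - ε) - G (-1) := by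
    apply intervalIntegral.integral_eq_sub_of_hasDerivAt_of_le hl.le
    · apply hGc.mono
      intro x hx
      exact ⟨⟨hx.1, by linarith [hx.2]⟩, by intro h; simp at h; linarith [hx.2]⟩
    · intro x hx
      exact hGd x ⟨hx.1, by linarith [hx.2]⟩ (by intro h; linarith [hx.2])
    · exact intL cw h0 hl
  have i2 : ∫ s in (r + ε)..(1:ℝ), √(1 - s ^ 2) / (s - r) = G 1 - G (r + ε) := by
    apply intervalIntegral.integral_eq_sub_of_hasDerivAt_of_le hu.le
    · apply hGc.mono
      intro x hx
      exact ⟨⟨by linarith [hx.1], hx.2⟩, by intro h; simp at h; linarith [hx.1]⟩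
    · intro x hx
      exact hGd x ⟨by linarith [hx.1], hx.2⟩ (by intro h; linarith [hx.1])
    · exact intR cw h0 hu
  rw [i1, i2]
  simp only [hG]
  have e1 : r - ε - r = -ε := by ring
  have e2 : r + ε - r = ε := by ring
  rw [e1, e2, Real.log_neg_eq_log]
  ring

open Polynomial.Chebyshev in
lemma int_wU (k : ℕ) : ∫ s in (-1:ℝ)..1, √(1 - s ^ 2) * (U ℝ k).eval s =
    if k = 0 then Real.pi / 2 else 0 := by
  have h := intervalIntegral.integral_comp_mul_deriv (a := 0) (b := Real.pi) (f := Real.cos)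
    (f' := fun x => - Real.sin x) (g := fun s => √(1 - s ^ 2) * (U ℝ k).eval s)
    (fun x _ => Real.hasDerivAt_cos x) (by fun_prop) (by fun_prop)
  rw [Real.cos_zero, Real.cos_pi, intervalIntegral.integral_symm (-1) 1] at h
  have h2 : ∫ x in (0:ℝ)..Real.pi, ((fun s => √(1 - s ^ 2) * (U ℝ k).eval s) ∘ Real.cos) x * - Real.sin x
     = ∫ x in (0:ℝ)..Real.pi, (1/2) * (Real.cos ((k + 2 : ℝ) * x) - Real.cos (k * x)) := by
    apply intervalIntegral.integral_congr
    intro x hx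
    rw [Set.uIcc_of_le Real.pi_pos.le] at hx
    have hs : √(1 - Real.cos x ^ 2) = Real.sin x := by
      rw [← Real.sin_sq, Real.sqrt_sq (Real.sin_nonneg_of_nonneg_of_le_pi hx.1 hx.2)]
    have hu := U_real_cos x k
    push_cast at hu
    simp only [Function.comp, hs]
    have e1 : (k + 2 : ℝ) * x = (k + 1) * x + x := by ring
    have e2 : (k : ℝ) * x = (k + 1) * x - x := by ring
    rw [e1, e2, Real.cos_add, Real.cos_sub]
    linear_combination (- Real.sin x) * hu
  rw [h2, intervalIntegral.integral_const_mul, intervalIntegral.integral_sub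
    (Continuous.intervalIntegrable (by fun_prop) _ _)
    (Continuous.intervalIntegrable (by fun_prop) _ _)] at h
  have hz : ∀ j : ℕ, j ≠ 0 → ∫ x in (0:ℝ)..Real.pi, Real.cos (j * x) = 0 := by
    intro j hj
    rw [intervalIntegral.integral_comp_mul_left _ (by exact_mod_cast hj)]
    simp [Real.sin_nat_mul_pi]
  have h3 := hz (k+2) (by omega)
  push_cast at h3
  rw [h3] at h
  split_ifs with hk
  · subst hk
    simp at h
    simp
    linarith
  · rw [hz k hk] at h
    linarith

open Polynomial.Chebyshev in
lemma isPV_U {r : ℝ} (hr : r ∈ Set.Ioo (-1 : ℝ) 1) (k : ℕ) :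
    IsPV (fun s => √(1 - s ^ 2) * (U ℝ k).eval s) r (-Real.pi * (T ℝ (k + 1)).eval r) ∧
    IsPV (fun s => √(1 - s ^ 2) * (U ℝ (k + 1)).eval s) r (-Real.pi * (T ℝ (k + 2)).eval r) := by
  induction k with
  | zero =>
    constructor
    · simpa using isPV_sqrt hr
    · have h := IsPV.mul_id (by fun_prop) hr (isPV_sqrt hr)
      have h' := IsPV.lin hr (by fun_prop) (by fun_prop) h h 1 1
      have e := int_wU 0
      simp at e
      rw [e] at h'
      have e2 : 1 * (Real.pi / 2 + r * (-Real.pi * r)) + 1 * (Real.pi / 2 + r * (-Real.pi * r))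
        = -Real.pi * (T ℝ (((0:ℕ):ℤ) + 2)).eval r := by
        simp [T_two]; ring
      rw [e2] at h'
      apply h'.congr hr
      intro s _
      simp; ring
  | succ k ih =>
    obtain ⟨h1, h2⟩ := ih
    have e : ((k + 1 : ℕ) : ℤ) = (k : ℤ) + 1 := by push_cast; ring
    rw [e]
    refine ⟨by rw [add_assoc]; exact h2, ?_⟩
    have h := IsPV.mul_id (by fun_prop) hr h2
    have h' := IsPV.lin hr (by fun_prop) (by fun_prop) h h1 2 (-1)
    have e0 := int_wU (k + 1)
    rw [e, if_neg (by omega)] at e0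
    rw [e0] at h'
    have eT : (T ℝ ((k:ℤ) + 1 + 2)).eval r = 2 * r * (T ℝ ((k:ℤ) + 2)).eval r - (T ℝ ((k:ℤ) + 1)).eval r := by
      rw [T_add_two]; simp [add_assoc]
    have eU : ∀ s, (U ℝ ((k:ℤ) + 1 + 1)).eval s = 2 * s * (U ℝ ((k:ℤ) + 1)).eval s - (U ℝ (k:ℤ)).eval s := by
      intro s
      rw [add_assoc, one_add_one_eq_two, U_add_two]; simp
    rw [eT]
    have e2 : -Real.pi * (2 * r * (T ℝ ((k:ℤ) + 2)).eval r - (T ℝ ((k:ℤ) + 1)).eval r) =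
      2 * (0 + r * (-Real.pi * (T ℝ ((k:ℤ) + 2)).eval r)) + -1 * (-Real.pi * (T ℝ ((k:ℤ) + 1)).eval r) := by ring
    rw [e2]
    apply h'.congr hr
    intro s _
    rw [eU]
    ring

open Polynomial.Chebyshev in
lemma U_diff (s : ℝ) (p : ℕ) : (fwdDiff (2:ℤ))^[2 * p] (fun k : ℤ => (U ℝ k).eval s) =
    fun k : ℤ => (-4 * (1 - s ^ 2)) ^ p * (U ℝ (k + 2 * p)).eval s := by
  induction p with
  | zero => simp
  | succ p ih =>
    have : 2 * (p + 1) = (2 * p).succ.succ := by omega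
    rw [this, Function.iterate_succ_apply', Function.iterate_succ_apply', ih]
    funext k
    simp only [fwdDiff]
    have f : ∀ j : ℤ, (U ℝ (j + 2)).eval s = 2 * s * (U ℝ (j+1)).eval s - (U ℝ j).eval s := by
      intro j; rw [U_add_two]; simp
    set q := k + 2 * (p:ℤ) with hq
    have a0 : k + 2 + 2 * (p:ℤ) = q + 2 := by rw [hq]; ring
    have a1 : k + 2 + 2 + 2 * (p:ℤ) = q + 1 + 1 + 2 := by rw [hq]; ring
    have a2 : k + 2 * ((p + 1 : ℕ):ℤ) = q + 2 := by rw [hq]; push_cast; ring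
    rw [a0, a1, a2, f (q + 1 + 1)]
    have a3 : q + 1 + 1 = q + 2 := by ring
    have a4 : q + 1 + 1 + 1 = q + 1 + 2 := by ring
    rw [a4, f (q+1), a3]
    linear_combination (-4 * (1 - s ^ 2)) ^ p * f q

open Polynomial.Chebyshev in
lemma poly_id (m n : ℕ) (hm : 1 ≤ m) (s : ℝ) :
    (1 - s ^ 2) ^ (m - 1) * (T ℝ n).eval s =
    ∑ j ∈ Finset.range (2 * m), ((-1 : ℝ) ^ m * (1 / 2 : ℝ) ^ (2 * m - 1) * ((-1 : ℝ) ^ j *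
      (Nat.choose (2 * m - 1) j : ℝ))) * (U ℝ ((n : ℤ) - 2 * m + 2 * j)).eval s := by
  obtain ⟨p, rfl⟩ : ∃ p, m = p + 1 := ⟨m - 1, by omega⟩
  have h := fwdDiff_iter_eq_sum_shift (2:ℤ) (fun k : ℤ => (U ℝ k).eval s) (2 * p + 1)
    ((n : ℤ) - 2 * (p + 1))
  rw [Function.iterate_succ_apply', U_diff] at h
  simp only [fwdDiff] at h
  have a1 : (n:ℤ) - 2 * (p + 1) + 2 + 2 * p = (n - 2) + 2 := by ring
  have a2 : (n:ℤ) - 2 * (p + 1) + 2 * p = n - 2 := by ring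
  rw [a1, a2, U_eq_two_mul_T_add_U] at h
  have a3 : (n:ℤ) - 2 + 2 = n := by ring
  rw [a3] at h
  have b1 : 2 * (p + 1) - 1 = 2 * p + 1 := by omega
  have b2 : 2 * (p + 1) = 2 * p + 1 + 1 := by omega
  have h4 : (1 - s ^ 2) ^ p * (T ℝ n).eval s = ((-1) ^ p * (1/2) ^ (2 * p + 1)) *
      ∑ k ∈ Finset.range (2 * p + 1 + 1), ((-1 : ℤ) ^ (2 * p + 1 - k) * (2 * p + 1).choose k) •
        (U ℝ ((n:ℤ) - 2 * (p + 1) + k • 2)).eval s := by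
    rw [← h]
    simp only [Polynomial.eval_add, Polynomial.eval_mul, Polynomial.eval_ofNat]
    have c : ((-1:ℝ)) ^ p * (1/2) ^ (2 * p + 1) * (-4 * (1 - s^2)) ^ p = (1/2) * (1 - s^2)^p := by
      have e : ((-1:ℝ) * (1/2) ^ 2 * (-4 * (1 - s^2))) ^ p = (1 - s^2) ^ p := by
        congr 1; ring
      rw [mul_pow, mul_pow] at e
      rw [pow_succ, pow_mul]
      linear_combination (1/2) * e
    linear_combination (-2 * (T ℝ n).eval s) * c
  rw [b1, Nat.add_sub_cancel, h4, Finset.mul_sum, b2]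
  apply Finset.sum_congr rfl
  intro j hj
  have hj' : j ≤ 2 * p + 1 := by simp at hj; omega
  have hs : (-1:ℝ) ^ (2 * p + 1 - j) = - (-1) ^ j := by
    have : (-1:ℝ) ^ (2 * p + 1 - j) * (-1) ^ j = -1 := by
      rw [← pow_add, Nat.sub_add_cancel hj', pow_succ, pow_mul]; simp
    have h2 : (-1:ℝ)^j * (-1)^j = 1 := by rw [← mul_pow]; simp
    linear_combination (-1)^j * this - (-1:ℝ) ^ (2 * p + 1 - j) * h2
  have i : (n:ℤ) - 2 * (p + 1) + j • 2 = (n:ℤ) - 2 * ((p + 1 : ℕ):ℤ) + 2 * j := by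
    simp; ring
  rw [i, zsmul_eq_mul]
  push_cast
  rw [hs]
  ring

theorem hfp2_T_general (m n : ℕ) (hm : 1 ≤ m) (hn : 2 * m + 1 ≤ n) (F : ℝ → ℝ)
    (hF : ∀ r ∈ Set.Ioo (-1 : ℝ) 1,
      Filter.Tendsto
        (fun ε : ℝ =>
          (∫ s in (-1 : ℝ)..(r - ε),
              (Polynomial.Chebyshev.T ℝ n).eval s * (1 - s ^ 2) ^ ((m : ℝ) - 1 / 2) / (s - r)) +
          ∫ s in (r + ε)..(1 : ℝ),
              (Polynomial.Chebyshev.T ℝ n).eval s * (1 - s ^ 2) ^ ((m : ℝ) - 1 / 2) / (s - r))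
        (nhdsWithin 0 (Set.Ioi 0)) (nhds (F r))) :
    ∀ r ∈ Set.Ioo (-1 : ℝ) 1,
      HasDerivAt F
        (Real.pi * (-1 : ℝ) ^ (m + 1) * (1 / 2 : ℝ) ^ (2 * m - 1) *
          ∑ j ∈ Finset.range (2 * m), (-1 : ℝ) ^ j * (Nat.choose (2 * m - 1) j : ℝ) *
            ((n : ℝ) + 1 - 2 * m + 2 * j) *
            (Polynomial.Chebyshev.U ℝ ((n : ℤ) - 2 * m + 2 * j)).eval r) r := by
  intro r hr
  set c : ℕ → ℝ := fun j => ((-1 : ℝ) ^ m * (1 / 2 : ℝ) ^ (2 * m - 1) * ((-1 : ℝ) ^ j *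
      (Nat.choose (2 * m - 1) j : ℝ))) with hc
  have key : ∀ x ∈ Set.Ioo (-1 : ℝ) 1, F x = ∑ j ∈ Finset.range (2 * m), c j *
      (-Real.pi * (Polynomial.Chebyshev.T ℝ ((n : ℤ) - 2 * m + 2 * j + 1)).eval x) := by
    intro x hx
    refine tendsto_nhds_unique (hF x hx) ?_
    have h := IsPV.sum (Finset.range (2 * m)) c
      (fun j s => √(1 - s ^ 2) * (Polynomial.Chebyshev.U ℝ ((n : ℤ) - 2 * m + 2 * j)).eval s)
      (fun j => -Real.pi * (Polynomial.Chebyshev.T ℝ ((n : ℤ) - 2 * m + 2 * j + 1)).eval x) hx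
      (fun i _ => by fun_prop)
      (fun i _ => by
        have := (isPV_U hx (n - 2 * m + 2 * i)).1
        have e : ((n - 2 * m + 2 * i : ℕ) : ℤ) = (n : ℤ) - 2 * m + 2 * i := by omega
        rwa [e] at this)
    refine IsPV.congr (g₂ := fun s => (Polynomial.Chebyshev.T ℝ n).eval s *
      (1 - s ^ 2) ^ ((m : ℝ) - 1 / 2)) hx ?_ h
    intro s hs
    have h0 : 0 ≤ 1 - s ^ 2 := by nlinarith [hs.1, hs.2]
    have hp : (1 - s ^ 2) ^ ((m : ℝ) - 1 / 2) = (1 - s ^ 2) ^ (m - 1) * √(1 - s ^ 2) := by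
      have : (m : ℝ) - 1 / 2 = ((m - 1 : ℕ) : ℝ) + 1 / 2 := by
        rw [Nat.cast_sub hm]; push_cast; ring
      rw [this, Real.rpow_add_of_nonneg h0 (by positivity) (by positivity), Real.rpow_natCast,
        Real.sqrt_eq_rpow]
    have := poly_id m n hm s
    have e3 : (Polynomial.Chebyshev.T ℝ n).eval s * ((1 - s ^ 2) ^ (m - 1) * √(1 - s ^ 2)) =
      ((1 - s ^ 2) ^ (m - 1) * (Polynomial.Chebyshev.T ℝ n).eval s) * √(1 - s ^ 2) := by ring
    rw [hp, e3, this, Finset.sum_mul]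
    apply Finset.sum_congr rfl
    intro j _
    simp only [hc]
    ring
  have hd : HasDerivAt (fun x => ∑ j ∈ Finset.range (2 * m), c j *
      (-Real.pi * (Polynomial.Chebyshev.T ℝ ((n : ℤ) - 2 * m + 2 * j + 1)).eval x))
      (∑ j ∈ Finset.range (2 * m), c j *
      (-Real.pi * (Polynomial.derivative
        (Polynomial.Chebyshev.T ℝ ((n : ℤ) - 2 * m + 2 * j + 1))).eval r)) r := by
    apply HasDerivAt.fun_sum
    intro j _
    exact ((Polynomial.hasDerivAt _ r).const_mul _).const_mul _
  have := hd.congr_of_eventuallyEq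
    (Filter.eventually_of_mem (Ioo_mem_nhds hr.1 hr.2) key)
  convert! this using 1
  rw [Finset.mul_sum]
  apply Finset.sum_congr rfl
  intro j _
  rw [Polynomial.Chebyshev.T_derivative_eq_U, add_sub_cancel_right, Polynomial.eval_mul,
    Polynomial.eval_intCast]
  push_cast
  simp only [hc]
  ring
end

section
/- Let m ≥ 2 and n ≥ 2m be integers and define F : (−1, 1) → ℝ by F(r) = ⨍_{−1}^{1} U_n(s)·(1−s²)^{m−1/2}/(s−r) ds (Cauchy principal value). Then F is twice differentiable on (−1, 1) and F″(r) = 2 · (−1)^m·(1/2)^{2m}·(π/(1−r²)) · Σ_{j=0}^{2m−2} (−1)^j · C(2m−2, j) · (n+3−2m+2j) · [ (n+4−2m+2j)·U_{n+1−2m+2j}(r) − (n+2−2m+2j)·U_{n+3−2m+2j}(r) ], where C(2m−2, j) denotes the binomial coefficient. (The cubic Hadamard finite-part integral ⨎_{−1}^{1} U_n(s)·(1−s²)^{m−1/2}/(s−r)³ ds equals F″(r)/2.) -/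
open Polynomial Polynomial.Chebyshev in
theorem aux_step (x : ℝ) (k : ℤ) :
    (U ℝ (k + 4)).eval x - 2 * (U ℝ (k + 2)).eval x + (U ℝ k).eval x
      = (-4 * (1 - x ^ 2)) * (U ℝ (k + 2)).eval x := by
  have h1 := congrArg (eval x) (U_add_two ℝ k)
  have h2 := congrArg (eval x) (U_add_two ℝ (k + 1))
  have h3 := congrArg (eval x) (U_add_two ℝ (k + 2))
  rw [show k + 1 + 2 = k + 3 by ring, show k + 1 + 1 = k + 2 by ring] at h2
  rw [show k + 2 + 2 = k + 4 by ring, show k + 2 + 1 = k + 3 by ring] at h3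
  simp only [eval_sub, eval_mul, eval_X, eval_ofNat] at h1 h2 h3
  linear_combination h3 + 2 * x * h2 + h1

open Polynomial Polynomial.Chebyshev in
theorem aux_fwd (x : ℝ) (M : ℕ) (y : ℤ) :
    (fwdDiff (2 : ℤ))^[2 * M] (fun k : ℤ => (U ℝ k).eval x) y
      = (-4 * (1 - x ^ 2)) ^ M * (U ℝ (y + 2 * M)).eval x := by
  induction M generalizing y with
  | zero => simp
  | succ M ih =>
    rw [show 2 * (M + 1) = (2 * M + 1) + 1 by ring, Function.iterate_succ_apply',
      Function.iterate_succ_apply']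
    simp only [fwdDiff, ih]
    have := aux_step x (y + 2 * M)
    rw [show y + 2 + 2 + 2 * (M : ℤ) = y + 2 * M + 4 by ring,
      show y + 2 + 2 * (M : ℤ) = y + 2 * M + 2 by ring,
      show y + 2 * ((M + 1 : ℕ) : ℤ) = y + 2 * M + 2 by push_cast; ring, pow_succ]
    linear_combination (-4 * (1 - x ^ 2)) ^ M * this

open Polynomial Polynomial.Chebyshev in
theorem aux_expand (x : ℝ) (M : ℕ) (y : ℤ) :
    (1 - x ^ 2) ^ M * (U ℝ (y + 2 * M)).eval x = (-1 / 4) ^ M *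
      ∑ j ∈ Finset.range (2 * M + 1), (-1 : ℝ) ^ j * ((2 * M).choose j : ℝ) *
        (U ℝ (y + 2 * j)).eval x := by
  have h := aux_fwd x M y
  rw [fwdDiff_iter_eq_sum_shift] at h
  have e : ∑ j ∈ Finset.range (2 * M + 1), (-1 : ℝ) ^ j * ((2 * M).choose j : ℝ) *
        (U ℝ (y + 2 * j)).eval x = (-4 * (1 - x ^ 2)) ^ M * (U ℝ (y + 2 * M)).eval x := by
    rw [← h]
    refine Finset.sum_congr rfl fun j hj => ?_
    have hj' : j ≤ 2 * M := by simpa [Nat.lt_succ_iff] using hj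
    have : (-1 : ℝ) ^ (2 * M - j) = (-1) ^ j := by
      obtain ⟨i, hi⟩ := Nat.exists_eq_add_of_le hj'
      have h2 : (-1 : ℝ) ^ (j + i) = 1 := by rw [← hi]; simp
      rw [hi, Nat.add_sub_cancel_left]
      rw [pow_add] at h2
      have h3 : (-1 : ℝ) ^ j * (-1) ^ j = 1 := by rw [← pow_add, ← two_mul]; simp
      have h0 : (-1 : ℝ) ^ j ≠ 0 := by positivity
      exact mul_left_cancel₀ h0 (h2.trans h3.symm)
    rw [zsmul_eq_mul, nsmul_eq_mul, mul_comm (j : ℤ) 2]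
    push_cast
    rw [this]
  rw [e, ← mul_assoc, ← mul_pow]
  congr 2
  ring

open Polynomial Polynomial.Chebyshev in
theorem aux_deriv2 (x : ℝ) (N : ℤ) (hx : 1 - x ^ 2 ≠ 0) :
    (derivative (derivative (T ℝ N))).eval x = (1 / (2 * (1 - x ^ 2))) * (N *
      ((N + 1) * (U ℝ (N - 2)).eval x - (N - 1) * (U ℝ N).eval x)) := by
  have h1 := congrArg (eval x) (one_sub_X_sq_mul_derivative_derivative_T_eq_poly_in_T (R := ℝ) N)
  have hd := congrArg (eval x) (T_derivative_eq_U (R := ℝ) N)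
  have h2 := congrArg (eval x) (two_mul_T_eq_U_sub_U ℝ (N - 2))
  have h3 := congrArg (eval x) (U_eq ℝ N)
  simp at h1 h2 h3 hd
  rw [hd] at h1
  field_simp
  linear_combination 2 * h1 - N ^ 2 * h2 - N * h3

theorem aux_w_deriv (s : ℝ) (hs : s ∈ Set.Ioo (-1 : ℝ) 1) :
    HasDerivAt (fun s : ℝ => √(1 - s ^ 2)) (-s / √(1 - s ^ 2)) s := by
  have h0 : 0 < 1 - s ^ 2 := by nlinarith [hs.1, hs.2]
  have h := ((hasDerivAt_pow 2 s).const_sub 1).sqrt h0.ne'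
  convert h using 1
  have := (Real.sqrt_pos.2 h0).ne'
  simp; field_simp

open Polynomial Polynomial.Chebyshev in
theorem aux_int (k : ℕ) :
    ∫ s in (-1 : ℝ)..1, (U ℝ (k + 1 : ℕ)).eval s * √(1 - s ^ 2) = 0 := by
  set u := U ℝ (k + 1 : ℕ) with hu
  have key : ∫ s in (-1 : ℝ)..1, (-((k + 1 : ℝ) * (k + 3))) * (u.eval s * √(1 - s ^ 2)) = 
     (fun s : ℝ => (1 - s ^ 2) * √(1 - s ^ 2) * (derivative u).eval s) 1 -
     (fun s : ℝ => (1 - s ^ 2) * √(1 - s ^ 2) * (derivative u).eval s) (-1) := by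
    refine intervalIntegral.integral_eq_sub_of_hasDerivAt_of_le (a := (-1 : ℝ)) (b := 1)
      (f := fun s : ℝ => (1 - s ^ 2) * √(1 - s ^ 2) * (derivative u).eval s)
      (by norm_num) ?_ ?_ ?_
    · exact Continuous.continuousOn (by fun_prop)
    · intro s hs
      have h0 : 0 < 1 - s ^ 2 := by nlinarith [hs.1, hs.2]
      have hw := (Real.sqrt_pos.2 h0).ne'
      have h := ((((hasDerivAt_pow 2 s).const_sub 1).mul (aux_w_deriv s hs)).mul
        ((derivative u).hasDerivAt s))
      refine HasDerivAt.congr_deriv h ?_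
      have h1 := congrArg (eval s)
        (one_sub_X_sq_mul_derivative_derivative_U_eq_poly_in_U (R := ℝ) (k + 1 : ℕ))
      rw [← hu] at h1
      simp at h1 ⊢
      have hq := Real.sq_sqrt h0.le
      field_simp
      rw [hq]
      linear_combination (1 - s ^ 2) * h1
    · exact Continuous.intervalIntegrable (by fun_prop) _ _
  rw [intervalIntegral.integral_const_mul] at key
  simp at key
  have : ((k : ℝ) + 1) ≠ 0 ∧ ((k : ℝ) + 3) ≠ 0 := ⟨by positivity, by positivity⟩
  rcases key with h | h
  · rcases h with h | h
    · exact absurd (by linarith) this.1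
    · exact absurd (by linarith) this.2
  · exact_mod_cast h

theorem aux_iiL (g : ℝ → ℝ) (hg : Continuous g) (r ε : ℝ) (he : 0 < ε) (h : -1 < r - ε) :
    IntervalIntegrable (fun s => g s / (s - r)) MeasureTheory.volume (-1) (r - ε) := by
  apply ContinuousOn.intervalIntegrable
  rw [Set.uIcc_of_le h.le]
  refine hg.continuousOn.div (by fun_prop) fun s hs => ?_
  have := hs.2
  intro h'; linarith

theorem aux_iiR (g : ℝ → ℝ) (hg : Continuous g) (r ε : ℝ) (he : 0 < ε) (h : r + ε < 1) :
    IntervalIntegrable (fun s => g s / (s - r)) MeasureTheory.volume (r + ε) 1 := by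
  apply ContinuousOn.intervalIntegrable
  rw [Set.uIcc_of_le h.le]
  refine hg.continuousOn.div (by fun_prop) fun s hs => ?_
  have := hs.1
  intro h'; linarith

noncomputable def auxPV (g : ℝ → ℝ) (r ε : ℝ) : ℝ :=
  (∫ s in (-1 : ℝ)..(r - ε), g s / (s - r)) + ∫ s in (r + ε)..(1 : ℝ), g s / (s - r)

theorem aux_ev (r : ℝ) (hr : r ∈ Set.Ioo (-1 : ℝ) 1) :
    ∀ᶠ ε in nhdsWithin (0 : ℝ) (Set.Ioi 0), 0 < ε ∧ -1 < r - ε ∧ r + ε < 1 := by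
  have h : Set.Ioo (0 : ℝ) (min (r + 1) (1 - r)) ∈ nhdsWithin (0 : ℝ) (Set.Ioi 0) :=
    Ioo_mem_nhdsGT (lt_min (by linarith [hr.1]) (by linarith [hr.2]))
  filter_upwards [h] with ε he
  have h1 := lt_min_iff.1 he.2
  exact ⟨he.1, by linarith [h1.1], by linarith [h1.2]⟩

theorem aux_D (r s : ℝ) (hr : r ∈ Set.Ioo (-1 : ℝ) 1) (hs : s ∈ Set.Icc (-1 : ℝ) 1) :
    0 < 1 - r * s + √(1 - r ^ 2) * √(1 - s ^ 2) := by
  have : r * s < 1 := by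
    rcases hr with ⟨h1, h2⟩
    rcases hs with ⟨h3, h4⟩
    rcases le_or_gt 0 s with h | h <;> nlinarith
  have := mul_nonneg (Real.sqrt_nonneg (1 - r ^ 2)) (Real.sqrt_nonneg (1 - s ^ 2))
  linarith

noncomputable def auxH (r s : ℝ) : ℝ :=
  √(1 - s ^ 2) - r * Real.arcsin s
    - √(1 - r ^ 2) * Real.log (1 - r * s + √(1 - r ^ 2) * √(1 - s ^ 2))

theorem auxH_cont (r : ℝ) (hr : r ∈ Set.Ioo (-1 : ℝ) 1) :
    ContinuousOn (auxH r) (Set.Icc (-1) 1) := by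
  unfold auxH
  refine ContinuousOn.sub (Continuous.continuousOn (by fun_prop)) ?_
  refine ContinuousOn.mul (by fun_prop) (ContinuousOn.log (by fun_prop) fun s hs => ?_)
  exact (aux_D r s hr hs).ne'

theorem auxG_deriv (r s : ℝ) (hr : r ∈ Set.Ioo (-1 : ℝ) 1) (hs : s ∈ Set.Ioo (-1 : ℝ) 1)
    (hne : s ≠ r) :
    HasDerivAt (fun s => auxH r s + √(1 - r ^ 2) * Real.log (s - r))
      (√(1 - s ^ 2) / (s - r)) s := by
  have hD := aux_D r s hr (Set.Ioo_subset_Icc_self hs)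
  have h0 : 0 < 1 - s ^ 2 := by nlinarith [hs.1, hs.2]
  have h0r : 0 < 1 - r ^ 2 := by nlinarith [hr.1, hr.2]
  have hsr : s - r ≠ 0 := sub_ne_zero.2 hne
  have hw := aux_w_deriv s hs
  have ha := (Real.hasDerivAt_arcsin hs.1.ne' hs.2.ne).const_mul r
  have hl := (((((hasDerivAt_id s).const_mul r).const_sub 1).add
    (hw.const_mul (√(1 - r ^ 2)))).log hD.ne').const_mul (√(1 - r ^ 2))
  have hl2 := (((hasDerivAt_id s).sub_const r).log hsr).const_mul (√(1 - r ^ 2))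
  have h := ((hw.sub ha).sub hl).add hl2
  refine HasDerivAt.congr_deriv h ?_
  simp only [id, Pi.add_apply]
  have hq := Real.sq_sqrt h0.le
  have hqr := Real.sq_sqrt h0r.le
  have hw0 := (Real.sqrt_pos.2 h0).ne'
  set w := √(1 - s ^ 2)
  set ρ := √(1 - r ^ 2)
  have hD0 := hD.ne'
  have e : -(ρ * ((-(r * 1) + ρ * (-s / w)) / (1 - r * s + ρ * w))) + ρ * (1 / (s - r))
      = ρ ^ 2 / (w * (s - r)) := by
    field_simp
    linear_combination ρ ^ 2 * hq - ρ * w * hqr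
  have e2 : ρ ^ 2 / (w * (s - r)) = w / (s - r) + s / w + r * (1 / w) := by
    field_simp
    linear_combination hqr - hq
  linear_combination e + e2

theorem aux_base (r : ℝ) (hr : r ∈ Set.Ioo (-1 : ℝ) 1) :
    Filter.Tendsto (auxPV (fun s => √(1 - s ^ 2)) r) (nhdsWithin 0 (Set.Ioi 0))
      (nhds (-Real.pi * r)) := by
  have hc : ContinuousAt (auxH r) r := (auxH_cont r hr).continuousAt (Icc_mem_nhds hr.1 hr.2)
  have hl : Filter.Tendsto (fun ε : ℝ => auxH r (r - ε) - auxH r (r + ε) + -Real.pi * r)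
      (nhdsWithin 0 (Set.Ioi 0)) (nhds (auxH r r - auxH r r + -Real.pi * r)) := by
    refine Filter.Tendsto.add_const _ (Filter.Tendsto.sub ?_ ?_)
    · refine hc.tendsto.comp (tendsto_nhdsWithin_of_tendsto_nhds ?_)
      have : Continuous fun ε : ℝ => r - ε := by fun_prop
      simpa using this.tendsto 0
    · refine hc.tendsto.comp (tendsto_nhdsWithin_of_tendsto_nhds ?_)
      have : Continuous fun ε : ℝ => r + ε := by fun_prop
      simpa using this.tendsto 0
  rw [sub_self, zero_add] at hl
  refine hl.congr' ?_
  filter_upwards [aux_ev r hr] with ε he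
  obtain ⟨he, h1, h2⟩ := he
  have iL := intervalIntegral.integral_eq_sub_of_hasDerivAt_of_le (a := (-1 : ℝ)) (b := r - ε)
    (f := fun s => auxH r s + √(1 - r ^ 2) * Real.log (s - r)) (f' := fun s => √(1 - s ^ 2) / (s - r))
    h1.le ?_ ?_ (aux_iiL (fun s => √(1 - s ^ 2)) (by fun_prop) r ε he h1)
  have iR := intervalIntegral.integral_eq_sub_of_hasDerivAt_of_le (a := r + ε) (b := 1)
    (f := fun s => auxH r s + √(1 - r ^ 2) * Real.log (s - r)) (f' := fun s => √(1 - s ^ 2) / (s - r))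
    h2.le ?_ ?_ (aux_iiR (fun s => √(1 - s ^ 2)) (by fun_prop) r ε he h2)
  · rw [auxPV, iL, iR]
    have l1 : Real.log (r - ε - r) = Real.log (r + ε - r) := by
      rw [← Real.log_neg_eq_log]; congr 1; ring
    have l2 : Real.log (-1 - r) = Real.log (1 + r) := by
      rw [← Real.log_neg_eq_log]; congr 1; ring
    have e1 : auxH r 1 = - r * (Real.pi / 2) - √(1 - r ^ 2) * Real.log (1 - r) := by
      simp [auxH]
    have e2 : auxH r (-1) = r * (Real.pi / 2) - √(1 - r ^ 2) * Real.log (1 + r) := by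
      simp [auxH]
    simp only [l1, l2, e1, e2]
    ring
  · refine ((auxH_cont r hr).mono (Set.Icc_subset_Icc (by linarith) le_rfl)).add
      (ContinuousOn.mul (by fun_prop) (ContinuousOn.log (by fun_prop) fun s hs => ?_))
    have := hs.1
    intro h; linarith
  · intro s hs
    refine auxG_deriv r s hr ⟨by linarith [hs.1, hr.1], hs.2⟩ ?_
    have := hs.1
    intro h; linarith
  · refine ((auxH_cont r hr).mono (Set.Icc_subset_Icc le_rfl (by linarith))).add
      (ContinuousOn.mul (by fun_prop) (ContinuousOn.log (by fun_prop) fun s hs => ?_))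
    have := hs.2
    intro h; linarith
  · intro s hs
    refine auxG_deriv r s hr ⟨hs.1, by linarith [hs.2, hr.2]⟩ ?_
    have := hs.2
    intro h; linarith

theorem aux_cut (g : ℝ → ℝ) (hg : Continuous g) (r : ℝ) :
    Filter.Tendsto (fun ε : ℝ => (∫ s in (-1 : ℝ)..(r - ε), g s) + ∫ s in (r + ε)..(1 : ℝ), g s)
      (nhdsWithin 0 (Set.Ioi 0)) (nhds (∫ s in (-1 : ℝ)..1, g s)) := by
  have hi : ∀ a b, IntervalIntegrable g MeasureTheory.volume a b := fun a b =>
    hg.intervalIntegrable a b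
  have hP : Continuous fun x => ∫ s in (-1 : ℝ)..x, g s :=
    intervalIntegral.continuous_primitive hi _
  have h : Continuous fun ε : ℝ => (∫ s in (-1 : ℝ)..(r - ε), g s) +
      ((∫ s in (-1 : ℝ)..1, g s) - ∫ s in (-1 : ℝ)..(r + ε), g s) := by
    exact (hP.comp (by fun_prop : Continuous fun ε : ℝ => r - ε)).add
      (continuous_const.sub (hP.comp (by fun_prop : Continuous fun ε : ℝ => r + ε)))
  have h2 := h.tendsto 0
  simp only [sub_zero, add_zero, add_sub_cancel] at h2
  refine (tendsto_nhdsWithin_of_tendsto_nhds h2).congr fun ε => ?_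
  rw [intervalIntegral.integral_interval_sub_left (hi _ _) (hi _ _)]

theorem aux_PV_step (a b c : ℝ → ℝ) (ha : Continuous a) (hb : Continuous b)
    (hc : ∀ s, c s = 2 * s * a s - b s) (r A B : ℝ) (hr : r ∈ Set.Ioo (-1 : ℝ) 1)
    (hA : Filter.Tendsto (auxPV a r) (nhdsWithin 0 (Set.Ioi 0)) (nhds A))
    (hB : Filter.Tendsto (auxPV b r) (nhdsWithin 0 (Set.Ioi 0)) (nhds B)) :
    Filter.Tendsto (auxPV c r) (nhdsWithin 0 (Set.Ioi 0))
      (nhds (2 * (∫ s in (-1 : ℝ)..1, a s) + 2 * r * A - B)) := by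
  refine ((((aux_cut a ha r).const_mul 2).add (hA.const_mul (2 * r))).sub hB).congr' ?_
  filter_upwards [aux_ev r hr] with ε he
  obtain ⟨he, h1, h2⟩ := he
  have hi : ∀ a' b', IntervalIntegrable a MeasureTheory.volume a' b' := fun a' b' =>
    ha.intervalIntegrable a' b'
  have L : ∫ s in (-1 : ℝ)..(r - ε), c s / (s - r) = 2 * (∫ s in (-1 : ℝ)..(r - ε), a s)
      + 2 * r * (∫ s in (-1 : ℝ)..(r - ε), a s / (s - r))
      - ∫ s in (-1 : ℝ)..(r - ε), b s / (s - r) := by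
    rw [← intervalIntegral.integral_const_mul, ← intervalIntegral.integral_const_mul,
      ← intervalIntegral.integral_add ((hi _ _).const_mul 2)
        ((aux_iiL a ha r ε he h1).const_mul _),
      ← intervalIntegral.integral_sub (((hi _ _).const_mul 2).add
        ((aux_iiL a ha r ε he h1).const_mul _)) (aux_iiL b hb r ε he h1)]
    refine intervalIntegral.integral_congr fun s hs => ?_
    rw [Set.uIcc_of_le h1.le] at hs
    have : s - r ≠ 0 := by
      have := hs.2
      intro h; linarith
    simp only [hc]
    field_simp
    ring
  have R : ∫ s in (r + ε)..1, c s / (s - r) = 2 * (∫ s in (r + ε)..1, a s)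
      + 2 * r * (∫ s in (r + ε)..1, a s / (s - r))
      - ∫ s in (r + ε)..1, b s / (s - r) := by
    rw [← intervalIntegral.integral_const_mul, ← intervalIntegral.integral_const_mul,
      ← intervalIntegral.integral_add ((hi _ _).const_mul 2)
        ((aux_iiR a ha r ε he h2).const_mul _),
      ← intervalIntegral.integral_sub (((hi _ _).const_mul 2).add
        ((aux_iiR a ha r ε he h2).const_mul _)) (aux_iiR b hb r ε he h2)]
    refine intervalIntegral.integral_congr fun s hs => ?_
    rw [Set.uIcc_of_le h2.le] at hs
    have : s - r ≠ 0 := by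
      have := hs.1
      intro h; linarith
    simp only [hc]
    field_simp
    ring
  simp only [auxPV]
  rw [L, R]
  ring

open Polynomial Polynomial.Chebyshev in
theorem aux_PV_U (r : ℝ) (hr : r ∈ Set.Ioo (-1 : ℝ) 1) (k : ℕ) :
    Filter.Tendsto (auxPV (fun s => (U ℝ k).eval s * √(1 - s ^ 2)) r) (nhdsWithin 0 (Set.Ioi 0))
      (nhds (-Real.pi * (T ℝ (k + 1)).eval r)) := by
  induction k using Nat.twoStepInduction with
  | zero => simpa using aux_base r hr
  | one =>
    have hz : Filter.Tendsto (auxPV (fun _ => 0) r) (nhdsWithin 0 (Set.Ioi 0)) (nhds 0) := by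
      have : auxPV (fun _ => 0) r = fun _ => 0 := by
        funext ε
        simp [auxPV]
      rw [this]; exact tendsto_const_nhds
    have := aux_PV_step (fun s => √(1 - s ^ 2)) (fun _ => 0)
      (fun s => (U ℝ (1 : ℕ)).eval s * √(1 - s ^ 2)) (by fun_prop) (by fun_prop)
      (fun s => by simp) r _ _ hr (aux_base r hr) hz
    convert this using 2
    rw [integral_sqrt_one_sub_sq]
    norm_num [T_two]
    ring
  | more k ih1 ih2 =>
    have := aux_PV_step (fun s => (U ℝ (k + 1 : ℕ)).eval s * √(1 - s ^ 2))
      (fun s => (U ℝ k).eval s * √(1 - s ^ 2))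
      (fun s => (U ℝ (k + 2 : ℕ)).eval s * √(1 - s ^ 2)) (by fun_prop) (by fun_prop)
      (fun s => by
        push_cast
        rw [U_add_two]
        simp only [eval_sub, eval_mul, eval_X, eval_ofNat]
        ring) r _ _ hr ih2 ih1
    convert this using 2
    rw [aux_int]
    have h := congrArg (eval r) (T_add_two ℝ (k + 1))
    simp only [eval_sub, eval_mul, eval_X, eval_ofNat] at h
    push_cast
    rw [show (k : ℤ) + 2 + 1 = k + 1 + 2 by ring, h]
    ring

open Polynomial Polynomial.Chebyshev in
theorem aux_weight (m n : ℕ) (hm : 2 ≤ m) (hn : 2 * m ≤ n) (s : ℝ) (hs : s ∈ Set.Icc (-1 : ℝ) 1) :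
    (U ℝ n).eval s * (1 - s ^ 2) ^ ((m : ℝ) - 1 / 2) =
      ∑ j ∈ Finset.range (2 * m - 1), ((-1 / 4) ^ (m - 1) * ((-1 : ℝ) ^ j * ((2 * m - 2).choose j : ℝ))) *
        ((U ℝ ((n + 2 - 2 * m + 2 * j : ℕ) : ℤ)).eval s * √(1 - s ^ 2)) := by
  obtain ⟨M, rfl⟩ : ∃ M, m = M + 1 := ⟨m - 1, by omega⟩
  have h0 : 0 ≤ 1 - s ^ 2 := by nlinarith [hs.1, hs.2]
  have hM : (1 : ℝ) ≤ M := by exact_mod_cast (by omega : 1 ≤ M)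
  have e : (1 - s ^ 2) ^ (((M + 1 : ℕ) : ℝ) - 1 / 2) = (1 - s ^ 2) ^ M * √(1 - s ^ 2) := by
    rw [Real.sqrt_eq_rpow, ← Real.rpow_natCast (1 - s ^ 2) M, ← Real.rpow_add_of_nonneg h0 (by positivity)
      (by norm_num)]
    congr 1; push_cast; ring
  have h := aux_expand s M (n - 2 * M)
  rw [sub_add_cancel] at h
  rw [e, show 2 * (M + 1) - 1 = 2 * M + 1 by omega, show 2 * (M + 1) - 2 = 2 * M by omega,
    Nat.add_sub_cancel]
  calc _ = ((1 - s ^ 2) ^ M * (U ℝ n).eval s) * √(1 - s ^ 2) := by ring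
    _ = _ := by
      rw [h, Finset.mul_sum, Finset.sum_mul]
      refine Finset.sum_congr rfl fun j _ => ?_
      rw [show ((n + 2 - 2 * (M + 1) + 2 * j : ℕ) : ℤ) = n - 2 * M + 2 * j by omega]
      ring

theorem aux_PV_sum (N : ℕ) (c : ℕ → ℝ) (g : ℕ → ℝ → ℝ) (hg : ∀ j, Continuous (g j)) (f : ℝ → ℝ)
    (hf : ∀ s ∈ Set.Icc (-1 : ℝ) 1, f s = ∑ j ∈ Finset.range N, c j * g j s) (r : ℝ)
    (hr : r ∈ Set.Ioo (-1 : ℝ) 1) (A : ℕ → ℝ)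
    (hA : ∀ j, Filter.Tendsto (auxPV (g j) r) (nhdsWithin 0 (Set.Ioi 0)) (nhds (A j))) :
    Filter.Tendsto (auxPV f r) (nhdsWithin 0 (Set.Ioi 0))
      (nhds (∑ j ∈ Finset.range N, c j * A j)) := by
  refine (tendsto_finsetSum (Finset.range N) fun j _ => (hA j).const_mul (c j)).congr' ?_
  filter_upwards [aux_ev r hr] with ε he
  obtain ⟨he, h1, h2⟩ := he
  have L : ∫ s in (-1 : ℝ)..(r - ε), f s / (s - r) =
      ∑ j ∈ Finset.range N, c j * ∫ s in (-1 : ℝ)..(r - ε), g j s / (s - r) := by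
    simp_rw [← intervalIntegral.integral_const_mul]
    rw [← intervalIntegral.integral_finsetSum fun j _ =>
      (aux_iiL (g j) (hg j) r ε he h1).const_mul (c j)]
    refine intervalIntegral.integral_congr fun s hs => ?_
    rw [Set.uIcc_of_le h1.le] at hs
    rw [hf s ⟨hs.1, by linarith [hs.2, hr.2]⟩, Finset.sum_div]
    exact Finset.sum_congr rfl fun j _ => by ring
  have R : ∫ s in (r + ε)..1, f s / (s - r) =
      ∑ j ∈ Finset.range N, c j * ∫ s in (r + ε)..1, g j s / (s - r) := by
    simp_rw [← intervalIntegral.integral_const_mul]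
    rw [← intervalIntegral.integral_finsetSum fun j _ =>
      (aux_iiR (g j) (hg j) r ε he h2).const_mul (c j)]
    refine intervalIntegral.integral_congr fun s hs => ?_
    rw [Set.uIcc_of_le h2.le] at hs
    rw [hf s ⟨by linarith [hs.1, hr.1], hs.2⟩, Finset.sum_div]
    exact Finset.sum_congr rfl fun j _ => by ring
  simp only [auxPV]
  rw [L, R, ← Finset.sum_add_distrib]
  exact Finset.sum_congr rfl fun j _ => by ring

/-- Let `m ≥ 2`, `n ≥ 2m` and let `F` be the Cauchy principal value
`F(r) = ⨍_{-1}^{1} U_n(s)(1-s²)^{m-1/2}/(s-r) ds` on `(-1,1)`. Then `F` is twice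
differentiable on `(-1,1)` with `F''(r) = 2 (-1)^m (1/2)^{2m} (π/(1-r²))
Σ_{j=0}^{2m-2} (-1)^j C(2m-2,j) (n+3-2m+2j) [(n+4-2m+2j) U_{n+1-2m+2j}(r)
- (n+2-2m+2j) U_{n+3-2m+2j}(r)]`; the cubic Hadamard finite-part integral equals `F''(r)/2`. -/
theorem hfp3_U_general (m n : ℕ) (hm : 2 ≤ m) (hn : 2 * m ≤ n) (F : ℝ → ℝ)
    (hF : ∀ r ∈ Set.Ioo (-1 : ℝ) 1,
      Filter.Tendsto
        (fun ε : ℝ =>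
          (∫ s in (-1 : ℝ)..(r - ε),
              (Polynomial.Chebyshev.U ℝ n).eval s * (1 - s ^ 2) ^ ((m : ℝ) - 1 / 2) / (s - r)) +
          ∫ s in (r + ε)..(1 : ℝ),
              (Polynomial.Chebyshev.U ℝ n).eval s * (1 - s ^ 2) ^ ((m : ℝ) - 1 / 2) / (s - r))
        (nhdsWithin 0 (Set.Ioi 0)) (nhds (F r))) :
    ∃ F' : ℝ → ℝ,
      (∀ r ∈ Set.Ioo (-1 : ℝ) 1, HasDerivAt F (F' r) r) ∧
      (∀ r ∈ Set.Ioo (-1 : ℝ) 1,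
        HasDerivAt F'
          (2 * ((-1 : ℝ) ^ m * (1 / 2 : ℝ) ^ (2 * m) * (Real.pi / (1 - r ^ 2)) *
            ∑ j ∈ Finset.range (2 * m - 1), (-1 : ℝ) ^ j * (Nat.choose (2 * m - 2) j : ℝ) *
              ((n : ℝ) + 3 - 2 * m + 2 * j) *
              (((n : ℝ) + 4 - 2 * m + 2 * j) *
                  (Polynomial.Chebyshev.U ℝ ((n : ℤ) + 1 - 2 * m + 2 * j)).eval r -
               ((n : ℝ) + 2 - 2 * m + 2 * j) *
                  (Polynomial.Chebyshev.U ℝ ((n : ℤ) + 3 - 2 * m + 2 * j)).eval r))) r) := by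
  classical
  let c : ℕ → ℝ := fun j => (-1 / 4) ^ (m - 1) * ((-1 : ℝ) ^ j * ((2 * m - 2).choose j : ℝ))
  let K : ℕ → ℤ := fun j => (n : ℤ) + 3 - 2 * m + 2 * j
  let P : Polynomial ℝ := ∑ j ∈ Finset.range (2 * m - 1),
    Polynomial.C (c j * -Real.pi) * Polynomial.Chebyshev.T ℝ (K j)
  have hFP : ∀ r ∈ Set.Ioo (-1 : ℝ) 1, F r = P.eval r := by
    intro r hr
    have h := aux_PV_sum (2 * m - 1) c
      (fun j s => (Polynomial.Chebyshev.U ℝ ((n + 2 - 2 * m + 2 * j : ℕ) : ℤ)).eval s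
        * √(1 - s ^ 2)) (fun j => by fun_prop) _ (aux_weight m n hm hn) r hr _
      (fun j => aux_PV_U r hr (n + 2 - 2 * m + 2 * j))
    refine (tendsto_nhds_unique (hF r hr) h).trans ?_
    simp only [P, Polynomial.eval_finsetSum, Polynomial.eval_mul, Polynomial.eval_C]
    refine Finset.sum_congr rfl fun j _ => ?_
    rw [show ((n + 2 - 2 * m + 2 * j : ℕ) : ℤ) + 1 = K j by simp only [K]; omega]
    ring
  refine ⟨fun r => P.derivative.eval r, fun r hr => ?_, fun r hr => ?_⟩
  · refine (P.hasDerivAt r).congr_of_eventuallyEq ?_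
    filter_upwards [isOpen_Ioo.mem_nhds hr] with x hx using hFP x hx
  · refine (P.derivative.hasDerivAt r).congr_deriv ?_
    have h0 : 1 - r ^ 2 ≠ 0 := by nlinarith [hr.1, hr.2]
    have hc : ((-1 : ℝ) / 4) ^ (m - 1) = -4 * ((-1) ^ m * (1 / 2) ^ (2 * m)) := by
      obtain ⟨M, rfl⟩ : ∃ M, m = M + 1 := ⟨m - 1, by omega⟩
      rw [Nat.add_sub_cancel, pow_mul, ← mul_pow, pow_succ]
      norm_num
      ring
    simp only [P, Polynomial.derivative_sum, Polynomial.derivative_C_mul,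
      Polynomial.eval_finsetSum, Polynomial.eval_mul, Polynomial.eval_C]
    rw [Finset.mul_sum, Finset.mul_sum]
    refine Finset.sum_congr rfl fun j _ => ?_
    rw [aux_deriv2 r (K j) h0]
    simp only [c, hc, K]
    rw [show (n : ℤ) + 3 - 2 * m + 2 * j - 2 = n + 1 - 2 * m + 2 * j by ring]
    push_cast
    field_simp
    ring
end

section
/- Let n ≥ 0 be an integer and let r ∈ ℝ with |r| > 1. Then the (ordinary Lebesgue) integral ∫_{−1}^{1} U_n(s)·(1−s²)^{3/2}/(s−r)³ ds equals (π/2)·[ (n² + 2n + 3) − 3·(n+1)·|r|/√(r²−1) ]·( r − sgn(r)·√(r²−1) )^{n+1}, where sgn(r) = |r|/r denotes the sign of r. -/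
open Filter Topology in
lemma aux_uniq (r ρ : ℝ) (D : ℕ → ℝ) (hρ : ρ ^ 2 - 2 * r * ρ + 1 = 0)
    (h0 : D 0 = 0) (hD : ∀ k, D (k + 2) = 2 * r * D (k + 1) - D k)
    (hT : Tendsto (fun k => ρ ^ k * D k) atTop (𝓝 0)) : ∀ k, D k = 0 := by
  have hne : ρ ≠ 0 := by rintro rfl; norm_num at hρ
  have key : ∀ k, ρ ^ (k + 1) * D (k + 1) - ρ ^ 2 * (ρ ^ k * D k) = ρ * D 1 := by
    intro k
    induction k with
    | zero => simp [h0]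
    | succ k ih =>
      rw [← ih, hD k]
      have : ρ ^ (k + 1) * D (k + 1) * (ρ ^ 2 - 2 * r * ρ + 1) = 0 := by rw [hρ]; ring
      linear_combination -this
  have hl : Tendsto (fun k => ρ ^ (k + 1) * D (k + 1) - ρ ^ 2 * (ρ ^ k * D k)) atTop
      (𝓝 (0 - ρ ^ 2 * 0)) :=
    ((tendsto_add_atTop_iff_nat 1).2 hT).sub (hT.const_mul _)
  simp only [key] at hl
  have h1 : ρ * D 1 = 0 - ρ ^ 2 * 0 := tendsto_nhds_unique tendsto_const_nhds hl
  have h1 : D 1 = 0 := by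
    have : ρ * D 1 = 0 := by linarith
    exact (mul_eq_zero.1 this).resolve_left hne
  have : ∀ k, D k = 0 ∧ D (k + 1) = 0 := by
    intro k
    induction k with
    | zero => exact ⟨h0, h1⟩
    | succ k ih => exact ⟨ih.2, by rw [hD, ih.1, ih.2]; ring⟩
  exact fun k => (this k).1

noncomputable def auxB (r : ℝ) (m k : ℕ) : ℝ :=
  ∫ t in (0 : ℝ)..Real.pi, Real.sin (k * t) * Real.sin t / (r - Real.cos t) ^ m

lemma aux_ne (r : ℝ) (hr : 1 < |r|) (t : ℝ) : r - Real.cos t ≠ 0 := by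
  intro h
  have : r = Real.cos t := by linarith
  rw [this] at hr
  exact absurd (Real.abs_cos_le_one t) (not_le.2 hr)

lemma aux_int_s19 (r : ℝ) (hr : 1 < |r|) (m k : ℕ) :
    IntervalIntegrable (fun t => Real.sin (k * t) * Real.sin t / (r - Real.cos t) ^ m)
      MeasureTheory.volume 0 Real.pi := by
  apply Continuous.intervalIntegrable
  exact Continuous.div (by fun_prop) (by fun_prop) (fun t => pow_ne_zero _ (aux_ne r hr t))

lemma auxB_zero (r : ℝ) (m : ℕ) : auxB r m 0 = 0 := by simp [auxB]

lemma auxB_rec (r : ℝ) (hr : 1 < |r|) (m k : ℕ) :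
    auxB r (m + 1) (k + 2) = 2 * r * auxB r (m + 1) (k + 1) - auxB r (m + 1) k
      - 2 * auxB r m (k + 1) := by
  unfold auxB
  rw [← intervalIntegral.integral_const_mul, ← intervalIntegral.integral_const_mul,
    ← intervalIntegral.integral_sub, ← intervalIntegral.integral_sub]
  · apply intervalIntegral.integral_congr
    intro t _
    have hne := aux_ne r hr t
    have e1 : Real.sin (((k + 2 : ℕ) : ℝ) * t) =
        2 * Real.cos t * Real.sin (((k + 1 : ℕ) : ℝ) * t) - Real.sin (k * t) := by
      have a : ((k + 2 : ℕ) : ℝ) * t = ((k + 1 : ℕ) : ℝ) * t + t := by push_cast; ring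
      have b : (k : ℝ) * t = ((k + 1 : ℕ) : ℝ) * t - t := by push_cast; ring
      rw [a, b, Real.sin_add, Real.sin_sub]; ring
    simp only [e1]
    field_simp
    ring
  · exact ((aux_int_s19 r hr _ _).const_mul _).sub (aux_int_s19 r hr _ _)
  · exact (aux_int_s19 r hr _ _).const_mul _
  · exact (aux_int_s19 r hr _ _).const_mul _
  · exact aux_int_s19 r hr _ _

lemma auxB_bound (r : ℝ) (hr : 1 < |r|) (m k : ℕ) :
    |auxB r m k| ≤ ((|r| - 1) ^ m)⁻¹ * |Real.pi - 0| := by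
  have h := @intervalIntegral.norm_integral_le_of_norm_le_const ℝ _ _ 0 Real.pi
    ((|r| - 1) ^ m)⁻¹ (fun t => Real.sin (k * t) * Real.sin t / (r - Real.cos t) ^ m) ?_
  · exact h
  · intro t _
    rw [Real.norm_eq_abs, abs_div, abs_mul, abs_pow, div_eq_mul_inv]
    have h1 := Real.abs_sin_le_one (k * t)
    have h2 := Real.abs_sin_le_one t
    have h3 : |Real.sin (k * t)| * |Real.sin t| ≤ 1 := mul_le_one₀ h1 (abs_nonneg _) h2
    have h4 : |r| - 1 ≤ |r - Real.cos t| := by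
      have := abs_sub_abs_le_abs_sub r (Real.cos t)
      have := Real.abs_cos_le_one t
      linarith
    have h5 : (|r| - 1) ^ m ≤ |r - Real.cos t| ^ m := pow_le_pow_left₀ (by linarith) h4 m
    have h6 : (|r - Real.cos t| ^ m)⁻¹ ≤ ((|r| - 1) ^ m)⁻¹ :=
      inv_anti₀ (pow_pos (by linarith) _) h5
    calc _ ≤ 1 * (|r - Real.cos t| ^ m)⁻¹ := by gcongr
      _ ≤ _ := by rw [one_mul]; exact h6

lemma aux_cos (j : ℕ) : ∫ t in (0 : ℝ)..Real.pi, Real.cos (((j : ℝ) + 1) * t) = 0 := by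
  have hj : ((j : ℝ) + 1) ≠ 0 := by positivity
  rw [intervalIntegral.integral_comp_mul_left _ hj, integral_cos]
  have := Real.sin_nat_mul_pi (j + 1)
  push_cast at this
  simp [this]

open Filter Topology in
lemma auxB_tend (r ρ : ℝ) (hr : 1 < |r|) (h1 : |ρ| < 1) (m : ℕ) :
    Tendsto (fun k => ρ ^ k * auxB r m k) atTop (𝓝 0) := by
  apply squeeze_zero_norm (a := fun k => |ρ| ^ k * (((|r| - 1) ^ m)⁻¹ * |Real.pi - 0|))
  · intro k
    rw [Real.norm_eq_abs, abs_mul, abs_pow]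
    have := auxB_bound r hr m k
    gcongr
  · have := (tendsto_pow_atTop_nhds_zero_of_lt_one (abs_nonneg ρ) h1).mul_const
      (((|r| - 1) ^ m)⁻¹ * |Real.pi - 0|)
    simpa using this

lemma auxB0 (r : ℝ) (k : ℕ) : auxB r 0 (k + 1) = if k = 0 then Real.pi / 2 else 0 := by
  unfold auxB
  simp only [pow_zero, div_one]
  rcases k with _ | k
  · have : ∀ t : ℝ, Real.sin (((0 + 1 : ℕ) : ℝ) * t) * Real.sin t = Real.sin t ^ 2 := by
      intro t; simp [sq]
    simp only [this, integral_sin_sq]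
    simp
  · have : ∀ t : ℝ, Real.sin (((k + 1 + 1 : ℕ) : ℝ) * t) * Real.sin t =
        (1 / 2) * (Real.cos (((k : ℝ) + 1) * t) - Real.cos ((((k + 2 : ℕ) : ℝ) + 1) * t)) := by
      intro t
      have a : ((k : ℝ) + 1) * t = ((k + 1 + 1 : ℕ) : ℝ) * t - t := by push_cast; ring
      have b : (((k + 2 : ℕ) : ℝ) + 1) * t = ((k + 1 + 1 : ℕ) : ℝ) * t + t := by push_cast; ring
      rw [a, b, Real.cos_add, Real.cos_sub]; ring
    simp only [this]
    rw [intervalIntegral.integral_const_mul, intervalIntegral.integral_sub, aux_cos, aux_cos]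
    · simp
    · exact Continuous.intervalIntegrable (by fun_prop) _ _
    · exact Continuous.intervalIntegrable (by fun_prop) _ _

open Filter Topology in
lemma aux_poly (ρ : ℝ) (h1 : |ρ| < 1) (j : ℕ) :
    Tendsto (fun k : ℕ => ρ ^ k * ((k : ℝ) ^ j * ρ ^ k)) atTop (𝓝 0) := by
  have a := tendsto_pow_const_mul_const_pow_of_abs_lt_one j h1
  have b := tendsto_pow_atTop_nhds_zero_of_abs_lt_one h1
  simpa using b.mul a

open Filter Topology in
lemma auxB1 (r ρ : ℝ) (hr : 1 < |r|) (h1 : |ρ| < 1) (hρ : ρ ^ 2 - 2 * r * ρ + 1 = 0) (k : ℕ) :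
    auxB r 1 (k + 1) = Real.pi * ρ ^ (k + 1) := by
  have := aux_uniq r ρ (fun k => auxB r 1 k - if k = 0 then 0 else Real.pi * ρ ^ k) hρ
    (by simp [auxB_zero]) ?_ ?_ (k + 1)
  · simp only [Nat.add_eq_zero_iff, one_ne_zero, and_false, if_false] at this
    linarith
  · intro k
    simp only [auxB_rec r hr 0 k, auxB0]
    rcases k with _ | k
    · simp
      linear_combination (-Real.pi) * hρ
    · simp
      linear_combination (-Real.pi * ρ ^ (k + 1)) * hρ
  · have a := auxB_tend r ρ hr h1 1
    have b := (aux_poly ρ h1 0).const_mul Real.pi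
    have c := a.sub b
    simp only [mul_zero, sub_zero] at c
    refine c.congr' ?_
    filter_upwards [eventually_ne_atTop 0] with k hk
    simp [hk]; ring

open Filter Topology in
lemma auxB2 (r ρ q : ℝ) (hr : 1 < |r|) (h1 : |ρ| < 1) (hρ : ρ ^ 2 - 2 * r * ρ + 1 = 0)
    (hq : q ≠ 0) (hqr : ρ = r - q) (k : ℕ) :
    auxB r 2 k = Real.pi / q * (k * ρ ^ k) := by
  have := aux_uniq r ρ (fun k => auxB r 2 k - Real.pi / q * (k * ρ ^ k)) hρ
    (by simp [auxB_zero]) ?_ ?_ k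
  · linarith
  · intro k
    simp only [auxB_rec r hr 1 k, auxB1 r ρ hr h1 hρ]
    have hr' : r = ρ + q := by linarith
    subst hr'
    field_simp
    push_cast
    linear_combination (-Real.pi * k * ρ ^ k) * hρ
  · have a := auxB_tend r ρ hr h1 2
    have b := (aux_poly ρ h1 1).const_mul (Real.pi / q)
    have c := a.sub b
    simp only [mul_zero, sub_zero] at c
    refine c.congr ?_
    intro k
    ring

open Filter Topology in
lemma auxB3 (r ρ q : ℝ) (hr : 1 < |r|) (h1 : |ρ| < 1) (hρ : ρ ^ 2 - 2 * r * ρ + 1 = 0)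
    (hq : q ≠ 0) (hqr : ρ = r - q) (k : ℕ) :
    auxB r 3 k = Real.pi / 2 * (k ^ 2 * ρ ^ k / q ^ 2 + k * ρ ^ k * r / q ^ 3) := by
  have := aux_uniq r ρ (fun k => auxB r 3 k -
      Real.pi / 2 * (k ^ 2 * ρ ^ k / q ^ 2 + k * ρ ^ k * r / q ^ 3)) hρ
    (by simp [auxB_zero]) ?_ ?_ k
  · linarith
  · intro k
    simp only [auxB_rec r hr 2 k, auxB2 r ρ q hr h1 hρ hq hqr]
    have hr' : r = ρ + q := by linarith
    subst hr'
    field_simp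
    push_cast
    linear_combination (-Real.pi * k * ρ ^ k * (ρ + q + k * q)) * hρ
  · have a := auxB_tend r ρ hr h1 3
    have b := (aux_poly ρ h1 2).const_mul (Real.pi / 2 / q ^ 2)
    have b' := (aux_poly ρ h1 1).const_mul (Real.pi / 2 * r / q ^ 3)
    have c := (a.sub b).sub b'
    simp only [mul_zero, sub_zero] at c
    refine c.congr ?_
    intro k
    ring

lemma aux_subst (n : ℕ) (r : ℝ) (hr : 1 < |r|) :
    ∫ s in (-1 : ℝ)..1,
        (Polynomial.Chebyshev.U ℝ n).eval s * (1 - s ^ 2) ^ ((3 : ℝ) / 2) / (s - r) ^ 3 =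
      ∫ t in (0 : ℝ)..Real.pi, Real.sin ((n + 1 : ℕ) * t) * Real.sin t ^ 3 /
        (Real.cos t - r) ^ 3 := by
  have h := @intervalIntegral.integral_comp_mul_deriv'' 0 Real.pi Real.cos (fun t => - Real.sin t)
    (fun s => (Polynomial.Chebyshev.U ℝ n).eval s * (1 - s ^ 2) ^ ((3 : ℝ) / 2) / (s - r) ^ 3)
    (by fun_prop) (fun x _ => (Real.hasDerivAt_cos x).hasDerivWithinAt) (by fun_prop) ?_
  · rw [Real.cos_zero, Real.cos_pi] at h
    rw [intervalIntegral.integral_symm, ← h, ← intervalIntegral.integral_neg]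
    apply intervalIntegral.integral_congr
    intro t ht
    rw [Set.uIcc_of_le Real.pi_pos.le] at ht
    have hs : 0 ≤ Real.sin t := Real.sin_nonneg_of_mem_Icc ht
    have e : (1 - Real.cos t ^ 2) ^ ((3 : ℝ) / 2) = Real.sin t ^ 3 := by
      rw [← Real.sin_sq, ← Real.rpow_natCast, ← Real.rpow_natCast, ← Real.rpow_mul hs]
      norm_num
    have u := Polynomial.Chebyshev.U_real_cos t n
    simp only [Function.comp, e]
    push_cast at u ⊢
    rw [← u]; ring
  · rintro s ⟨t, -, rfl⟩
    apply ContinuousAt.continuousWithinAt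
    have hne : (Real.cos t - r) ^ 3 ≠ 0 := by
      apply pow_ne_zero
      have := aux_ne r hr t
      intro h; apply this; linarith
    refine ContinuousAt.div (f := fun s => (Polynomial.Chebyshev.U ℝ n).eval s * (1 - s ^ 2) ^ ((3 : ℝ) / 2))
      (g := fun s => (s - r) ^ 3) ?_ (by fun_prop) hne
    refine ContinuousAt.mul (by fun_prop) ?_
    exact ContinuousAt.rpow_const (by fun_prop) (Or.inr (by norm_num))

lemma aux_split (k : ℕ) (r : ℝ) (hr : 1 < |r|) :
      ∫ t in (0 : ℝ)..Real.pi, Real.sin (k * t) * Real.sin t ^ 3 /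
        (Real.cos t - r) ^ 3 =
      (r ^ 2 - 1) * auxB r 3 k - 2 * r * auxB r 2 k + auxB r 1 k := by
  unfold auxB
  rw [← intervalIntegral.integral_const_mul, ← intervalIntegral.integral_const_mul,
    ← intervalIntegral.integral_sub, ← intervalIntegral.integral_add]
  · apply intervalIntegral.integral_congr
    intro t _
    have hne := aux_ne r hr t
    have e : (Real.cos t - r) ^ 3 = - (r - Real.cos t) ^ 3 := by ring
    have e2 : Real.sin t ^ 3 = Real.sin t * (1 - Real.cos t ^ 2) := by
      rw [← Real.sin_sq]; ring
    simp only [e, e2]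
    field_simp
    ring
  · exact ((aux_int_s19 r hr _ _).const_mul _).sub ((aux_int_s19 r hr _ _).const_mul _)
  · exact aux_int_s19 r hr _ _
  · exact (aux_int_s19 r hr _ _).const_mul _
  · exact (aux_int_s19 r hr _ _).const_mul _


/-- For an integer `n ≥ 0` and real `r` with `|r| > 1`,
`∫_{-1}^{1} U_n(s)(1-s²)^{3/2}/(s-r)³ ds
  = (π/2) ((n² + 2n + 3) - 3(n+1)|r|/√(r²-1)) (r - (|r|/r)√(r²-1))^{n+1}`. -/
theorem S3_U_m2 (n : ℕ) (r : ℝ) (hr : 1 < |r|) :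
    ∫ s in (-1 : ℝ)..1,
        (Polynomial.Chebyshev.U ℝ n).eval s * (1 - s ^ 2) ^ ((3 : ℝ) / 2) / (s - r) ^ 3 =
      Real.pi / 2 *
        (((n : ℝ) ^ 2 + 2 * n + 3) - 3 * ((n : ℝ) + 1) * |r| / Real.sqrt (r ^ 2 - 1)) *
        (r - |r| / r * Real.sqrt (r ^ 2 - 1)) ^ (n + 1) := by
  have hr0 : r ≠ 0 := by rintro rfl; norm_num at hr
  have hr2 : 0 < r ^ 2 - 1 := by
    have : 1 < r ^ 2 := by rw [← sq_abs]; nlinarith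
    linarith
  have hs : 0 < Real.sqrt (r ^ 2 - 1) := Real.sqrt_pos.2 hr2
  have hss := Real.sq_sqrt hr2.le
  have ha : 0 < |r| := abs_pos.2 hr0
  have haa := sq_abs r
  rw [aux_subst n r hr, aux_split _ r hr]
  set w := Real.sqrt (r ^ 2 - 1)
  obtain ⟨q, hq⟩ : ∃ q, q = |r| / r * w := ⟨_, rfl⟩
  have hq0 : q ≠ 0 := by rw [hq]; positivity
  have hq2 : q ^ 2 = r ^ 2 - 1 := by
    rw [hq, mul_pow, div_pow, haa, hss]; field_simp
  have hrq : r * q = |r| * w := by rw [hq]; field_simp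
  have hw : |r| / w = r / q := by
    rw [div_eq_div_iff hs.ne' hq0, hq]
    field_simp
    exact haa
  obtain ⟨ρ, hρ⟩ : ∃ ρ, ρ = r - q := ⟨_, rfl⟩
  have hρ2 : ρ ^ 2 - 2 * r * ρ + 1 = 0 := by rw [hρ]; linear_combination hq2
  have h1 : |ρ| < 1 := by
    have hm : ρ * (r + q) = 1 := by rw [hρ]; linear_combination -hq2
    have hp : 1 < |r + q| := by
      rw [← one_lt_sq_iff_one_lt_abs]
      nlinarith [mul_pos ha hs]
    have : |ρ| * |r + q| = 1 := by rw [← abs_mul, hm, abs_one]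
    nlinarith [abs_nonneg ρ]
  rw [auxB3 r ρ q hr h1 hρ2 hq0 hρ, auxB2 r ρ q hr h1 hρ2 hq0 hρ, auxB1 r ρ hr h1 hρ2,
    ← hq, ← hρ, mul_div_assoc (3 * ((n : ℝ) + 1)), hw, ← hq2]
  push_cast
  field_simp
  ring
end
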